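/- arXiv:math/0407432 — 2 statements merged into one kernel-verified Lean document; each statement's English description precedes it below -/
import Mathlib

section
/- Define X(x₀) for x₀ ≤ 0 as the infimum of left endpoints a of intervals of existence over all real solutions of y'' = 6y² − x regular at x₀. Then X(x₀) is finite, and as x₀ → −∞, X(x₀) = x₀ − 2C/|x₀|^{1/4} + O(|x₀|^{−3/2}), with 0 < X(x₀) − (x₀ − 2C/|x₀|^{1/4}) < C²/|x₀|^{3/2} for |x₀| > (2C)^{4/5}, where C is the constant max_{v<0} ∫₀^∞ dw/√(w⁴ + 3vw² + 3v² + 1/2). -/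
open Filter Set Topology MeasureTheory

/-- The universal constant `C = max_{v<0} ∫₀^∞ dw/√(w⁴+3vw²+3v²+1/2)`. -/
noncomputable def painleveC : ℝ :=
  sSup {c : ℝ | ∃ v : ℝ, v < 0 ∧
    c = ∫ w in Set.Ioi (0:ℝ), 1 / Real.sqrt (w ^ 4 + 3 * v * w ^ 2 + 3 * v ^ 2 + 1 / 2)}

/-- The integrand of the blow-up time of `u'' = 6u² + K` started at rest at the minimum `m`,
in the variable `w = √(u - m)`. -/
noncomputable def timeDensity (m K w : ℝ) : ℝ :=
  1 / Real.sqrt (w ^ 4 + 3 * m * w ^ 2 + 3 * m ^ 2 + K / 2)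

/-- The time after which `u'' = 6u² + K`, started at rest at `m`, reaches `m + w²`. -/
noncomputable def passageTime (m K w : ℝ) : ℝ := ∫ ω in (0:ℝ)..w, timeDensity m K ω

/-- The blow-up time of `u'' = 6u² + 1` started at rest at `v`. -/
noncomputable def blowupTime (v : ℝ) : ℝ := ∫ w in Ioi (0:ℝ), timeDensity v 1 w

lemma quartic_ge (m K w : ℝ) :
    w ^ 4 / 4 + K / 2 ≤ w ^ 4 + 3 * m * w ^ 2 + 3 * m ^ 2 + K / 2 := by
  nlinarith [sq_nonneg (2 * m + w ^ 2)]

lemma quartic_pos (m w : ℝ) {K : ℝ} (hK : 0 < K) :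
    0 < w ^ 4 + 3 * m * w ^ 2 + 3 * m ^ 2 + K / 2 :=
  lt_of_lt_of_le (by positivity) (quartic_ge m K w)

lemma timeDensity_pos (m w : ℝ) {K : ℝ} (hK : 0 < K) : 0 < timeDensity m K w :=
  div_pos one_pos (Real.sqrt_pos.2 (quartic_pos m w hK))

lemma continuous_timeDensity (m : ℝ) {K : ℝ} (hK : 0 < K) : Continuous (timeDensity m K) := by
  unfold timeDensity
  refine continuous_const.div (by fun_prop) fun w => ?_
  exact (Real.sqrt_pos.2 (quartic_pos m w hK)).ne'

lemma continuous_timeDensity_left (w : ℝ) {K : ℝ} (hK : 0 < K) :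
    Continuous fun m => timeDensity m K w := by
  unfold timeDensity
  refine continuous_const.div (by fun_prop) fun m => ?_
  exact (Real.sqrt_pos.2 (quartic_pos m w hK)).ne'

lemma timeDensity_one_le (m w : ℝ) : timeDensity m 1 w ≤ 3 * (1 + w ^ 2)⁻¹ := by
  unfold timeDensity
  have h1 : (1 + w ^ 2) / 3 ≤ Real.sqrt (w ^ 4 + 3 * m * w ^ 2 + 3 * m ^ 2 + 1 / 2) := by
    apply Real.le_sqrt_of_sq_le
    refine le_trans ?_ (quartic_ge m 1 w)
    nlinarith [sq_nonneg (w ^ 2 - 1), sq_nonneg (w ^ 2)]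
  have h2 : (0:ℝ) < (1 + w ^ 2) / 3 := by positivity
  calc 1 / Real.sqrt (w ^ 4 + 3 * m * w ^ 2 + 3 * m ^ 2 + 1 / 2) ≤ 1 / ((1 + w ^ 2) / 3) :=
        one_div_le_one_div_of_le h2 h1
    _ = 3 * (1 + w ^ 2)⁻¹ := by field_simp

lemma integrable_timeDensity_one (v : ℝ) : Integrable (timeDensity v 1) := by
  refine (integrable_inv_one_add_sq.const_mul 3).mono'
    (continuous_timeDensity v one_pos).aestronglyMeasurable (Eventually.of_forall fun w => ?_)
  rw [Real.norm_of_nonneg (timeDensity_pos v w one_pos).le]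
  exact timeDensity_one_le v w

lemma continuous_blowupTime : Continuous blowupTime := by
  unfold blowupTime
  refine continuous_of_dominated (bound := fun w => 3 * (1 + w ^ 2)⁻¹)
    (fun v => (continuous_timeDensity v one_pos).aestronglyMeasurable)
    (fun v => Eventually.of_forall fun w => ?_)
    (integrable_inv_one_add_sq.const_mul 3).integrableOn
    (Eventually.of_forall fun w => continuous_timeDensity_left w one_pos)
  rw [Real.norm_of_nonneg (timeDensity_pos v w one_pos).le]
  exact timeDensity_one_le v w

lemma blowupTime_pos (v : ℝ) : 0 < blowupTime v := by
  unfold blowupTime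
  rw [setIntegral_pos_iff_support_of_nonneg_ae
    (Eventually.of_forall fun w => (timeDensity_pos v w one_pos).le)
    (integrable_timeDensity_one v).integrableOn]
  have : Function.support (timeDensity v 1) = univ := by
    ext w
    simpa using (timeDensity_pos v w one_pos).ne'
  simp [this]

lemma painleveC_eq_sSup : painleveC = sSup (blowupTime '' Iio 0) := by
  unfold painleveC blowupTime timeDensity
  congr 1
  ext c
  constructor
  · rintro ⟨v, hv, rfl⟩
    exact ⟨v, hv, rfl⟩
  · rintro ⟨v, hv, rfl⟩
    exact ⟨v, hv, rfl⟩

lemma bddAbove_blowupTime : BddAbove (blowupTime '' Iio 0) := by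
  refine ⟨∫ w in Ioi (0:ℝ), 3 * (1 + w ^ 2)⁻¹, ?_⟩
  rintro _ ⟨v, -, rfl⟩
  exact setIntegral_mono (integrable_timeDensity_one v).integrableOn
    (integrable_inv_one_add_sq.const_mul 3).integrableOn fun w => timeDensity_one_le v w

lemma blowupTime_le (v : ℝ) : blowupTime v ≤ painleveC := by
  rw [painleveC_eq_sSup]
  have hneg : ∀ v < 0, blowupTime v ≤ sSup (blowupTime '' Iio 0) := fun v hv =>
    le_csSup bddAbove_blowupTime ⟨v, hv, rfl⟩
  rcases lt_or_ge v 0 with hv | hv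
  · exact hneg v hv
  · have h0 : blowupTime 0 ≤ sSup (blowupTime '' Iio 0) :=
      le_of_tendsto (continuous_blowupTime.continuousAt.tendsto.mono_left nhdsWithin_le_nhds)
        (eventually_mem_nhdsWithin.mono hneg : ∀ᶠ v in 𝓝[<] (0:ℝ), _)
    refine le_trans ?_ h0
    refine setIntegral_mono (integrable_timeDensity_one v).integrableOn
      (integrable_timeDensity_one 0).integrableOn fun w => ?_
    refine one_div_le_one_div_of_le (Real.sqrt_pos.2 (quartic_pos 0 w one_pos))
      (Real.sqrt_le_sqrt ?_)
    have : 0 ≤ v * w ^ 2 := by positivity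
    nlinarith [sq_nonneg v]

lemma painleveC_pos : 0 < painleveC := (blowupTime_pos 0).trans_le (blowupTime_le 0)

lemma exists_lt_blowupTime {c : ℝ} (hc : c < painleveC) : ∃ v, c < blowupTime v := by
  rw [painleveC_eq_sSup] at hc
  obtain ⟨_, ⟨v, -, rfl⟩, h⟩ := exists_lt_of_lt_csSup ((nonempty_Iio).image _) hc
  exact ⟨v, h⟩

lemma timeDensity_scale (m w : ℝ) {l : ℝ} (hl : 0 < l) :
    timeDensity m (l ^ 4) w = (l ^ 2)⁻¹ * timeDensity (m / l ^ 2) 1 (l⁻¹ * w) := by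
  unfold timeDensity
  have h : w ^ 4 + 3 * m * w ^ 2 + 3 * m ^ 2 + l ^ 4 / 2 =
      (l ^ 2) ^ 2 * ((l⁻¹ * w) ^ 4 + 3 * (m / l ^ 2) * (l⁻¹ * w) ^ 2 + 3 * (m / l ^ 2) ^ 2
        + 1 / 2) := by
    field_simp
  rw [h, Real.sqrt_mul (by positivity), Real.sqrt_sq (by positivity)]
  rw [one_div, mul_inv, ← one_div (√_)]

lemma integrable_timeDensity (m : ℝ) {l : ℝ} (hl : 0 < l) :
    Integrable (timeDensity m (l ^ 4)) := by
  have : timeDensity m (l ^ 4) =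
      fun w => (l ^ 2)⁻¹ * timeDensity (m / l ^ 2) 1 (l⁻¹ * w) :=
    funext fun w => timeDensity_scale m w hl
  rw [this]
  exact ((integrable_timeDensity_one _).comp_mul_left' (inv_ne_zero hl.ne')).const_mul _

lemma integral_timeDensity (m : ℝ) {l : ℝ} (hl : 0 < l) :
    ∫ w in Ioi (0:ℝ), timeDensity m (l ^ 4) w = blowupTime (m / l ^ 2) / l := by
  simp_rw [timeDensity_scale m _ hl]
  rw [integral_const_mul, integral_comp_mul_left_Ioi _ _ (inv_pos.2 hl), mul_zero, inv_inv,
    blowupTime, smul_eq_mul]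
  field_simp

lemma tendsto_passageTime (m : ℝ) {l : ℝ} (hl : 0 < l) :
    Tendsto (passageTime m (l ^ 4)) atTop (𝓝 (blowupTime (m / l ^ 2) / l)) := by
  rw [← integral_timeDensity m hl]
  exact intervalIntegral_tendsto_integral_Ioi 0 (integrable_timeDensity m hl).integrableOn
    tendsto_id

lemma hasDerivAt_passageTime (m w : ℝ) {K : ℝ} (hK : 0 < K) :
    HasDerivAt (passageTime m K) (timeDensity m K w) w :=
  intervalIntegral.integral_hasDerivAt_right
    ((continuous_timeDensity m hK).intervalIntegrable _ _)
    ((continuous_timeDensity m hK).stronglyMeasurableAtFilter _ _)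
    (continuous_timeDensity m hK).continuousAt

lemma strictMono_passageTime (m : ℝ) {K : ℝ} (hK : 0 < K) : StrictMono (passageTime m K) :=
  strictMono_of_hasDerivAt_pos (hasDerivAt_passageTime m · hK) (timeDensity_pos m · hK)

lemma passageTime_le (m w : ℝ) {l : ℝ} (hl : 0 < l) :
    passageTime m (l ^ 4) w ≤ blowupTime (m / l ^ 2) / l :=
  (strictMono_passageTime m (pow_pos hl 4)).monotone.ge_of_tendsto (tendsto_passageTime m hl) w

section Comparison

variable {u p f : ℝ → ℝ} {a b K : ℝ}

lemma deriv_pos_and_lt_of_forcing_pos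
    (hu : ∀ s ∈ Icc a b, HasDerivAt u (p s) s)
    (hp : ∀ s ∈ Icc a b, HasDerivAt p (6 * u s ^ 2 + f s) s)
    (hf : ∀ s ∈ Icc a b, 0 < f s) (hpa : 0 ≤ p a) {s : ℝ} (hs : s ∈ Ioc a b) :
    0 < p s ∧ u a < u s := by
  have hpmono : StrictMonoOn p (Icc a b) := by
    refine strictMonoOn_of_deriv_pos (convex_Icc a b)
      (fun s hs => (hp s hs).continuousAt.continuousWithinAt) fun s hs => ?_
    rw [interior_Icc] at hs
    have hs' := Ioo_subset_Icc_self hs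
    rw [(hp s hs').deriv]
    have := hf s hs'
    positivity
  have hab : a ≤ b := hs.1.le.trans hs.2
  have hppos : ∀ s ∈ Ioc a b, 0 < p s := fun s hs =>
    hpa.trans_lt (hpmono (left_mem_Icc.2 hab) (Ioc_subset_Icc_self hs) hs.1)
  have humono : StrictMonoOn u (Icc a b) := by
    refine strictMonoOn_of_deriv_pos (convex_Icc a b)
      (fun s hs => (hu s hs).continuousAt.continuousWithinAt) fun s hs => ?_
    rw [interior_Icc] at hs
    rw [(hu s (Ioo_subset_Icc_self hs)).deriv]
    exact hppos s (Ioo_subset_Ioc_self hs)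
  exact ⟨hppos s hs, humono (left_mem_Icc.2 hab) (Ioc_subset_Icc_self hs) hs.1⟩

/-- The energy of `u'' = 6u² + K`, normalized to vanish at rest at `m`. -/
def energy (K m y q : ℝ) : ℝ := q ^ 2 - (4 * (y ^ 3 - m ^ 3) + 2 * K * (y - m))

lemma hasDerivAt_energy (m : ℝ) {s : ℝ} (hu : HasDerivAt u (p s) s)
    (hp : HasDerivAt p (6 * u s ^ 2 + f s) s) :
    HasDerivAt (fun s => energy K m (u s) (p s)) (2 * p s * (f s - K)) s := by
  unfold energy
  refine ((hp.pow 2).sub ((((hu.pow 3).sub_const _).const_mul 4).add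
    ((hu.sub_const m).const_mul (2 * K)))).congr_deriv ?_
  push_cast
  ring

lemma energy_le_energy
    (hu : ∀ s ∈ Icc a b, HasDerivAt u (p s) s)
    (hp : ∀ s ∈ Icc a b, HasDerivAt p (6 * u s ^ 2 + f s) s)
    (hf : ∀ s ∈ Icc a b, 0 < f s) (hpa : 0 ≤ p a)
    (hfK : ∀ s ∈ Icc a b, K ≤ f s) (m : ℝ) {s : ℝ} (hs : s ∈ Icc a b) :
    energy K m (u a) (p a) ≤ energy K m (u s) (p s) := by
  have hd := fun s hs => hasDerivAt_energy (K := K) m (hu s hs) (hp s hs)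
  have hmono : MonotoneOn (fun s => energy K m (u s) (p s)) (Icc a b) := by
    refine monotoneOn_of_deriv_nonneg (convex_Icc a b)
      (fun s hs => (hd s hs).continuousAt.continuousWithinAt)
      (fun s hs => (hd s (interior_subset hs)).differentiableAt.differentiableWithinAt)
      fun s hs => ?_
    have hs' := interior_subset hs
    rw [interior_Icc] at hs
    rw [(hd s hs').deriv]
    have h1 := (deriv_pos_and_lt_of_forcing_pos hu hp hf hpa (Ioo_subset_Ioc_self hs)).1
    have h2 := sub_nonneg.2 (hfK s hs')
    positivity
  exact hmono (left_mem_Icc.2 (hs.1.trans hs.2)) hs hs.1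

lemma energy_le_energy_of_forcing_le
    (hu : ∀ s ∈ Icc a b, HasDerivAt u (p s) s)
    (hp : ∀ s ∈ Icc a b, HasDerivAt p (6 * u s ^ 2 + f s) s)
    (hf : ∀ s ∈ Icc a b, 0 < f s) (hpa : 0 ≤ p a)
    (hfK : ∀ s ∈ Icc a b, f s ≤ K) (m : ℝ) {s : ℝ} (hs : s ∈ Icc a b) :
    energy K m (u s) (p s) ≤ energy K m (u a) (p a) := by
  have hd := fun s hs => hasDerivAt_energy (K := K) m (hu s hs) (hp s hs)
  have hanti : AntitoneOn (fun s => energy K m (u s) (p s)) (Icc a b) := by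
    refine antitoneOn_of_deriv_nonpos (convex_Icc a b)
      (fun s hs => (hd s hs).continuousAt.continuousWithinAt)
      (fun s hs => (hd s (interior_subset hs)).differentiableAt.differentiableWithinAt)
      fun s hs => ?_
    have hs' := interior_subset hs
    rw [interior_Icc] at hs
    rw [(hd s hs').deriv]
    have h1 := (deriv_pos_and_lt_of_forcing_pos hu hp hf hpa (Ioo_subset_Ioc_self hs)).1
    exact mul_nonpos_of_nonneg_of_nonpos (by positivity) (sub_nonpos.2 (hfK s hs'))
  exact hanti (left_mem_Icc.2 (hs.1.trans hs.2)) hs hs.1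

lemma hasDerivAt_passageTime_sqrt_sub (hK : 0 < K) {m s : ℝ} (hu : HasDerivAt u (p s) s)
    (hm : m < u s) :
    HasDerivAt (fun s => passageTime m K √(u s - m))
      (p s / √(4 * (u s ^ 3 - m ^ 3) + 2 * K * (u s - m))) s := by
  have hm' : 0 < u s - m := sub_pos.2 hm
  refine ((hasDerivAt_passageTime m _ hK).comp s ((hu.sub_const m).sqrt hm'.ne')).congr_deriv ?_
  have hw : √(u s - m) ^ 2 = u s - m := Real.sq_sqrt hm'.le
  have h4 : √(u s - m) ^ 4 = (u s - m) ^ 2 := by rw [← hw, ← pow_mul, hw]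
  have key : 4 * (u s ^ 3 - m ^ 3) + 2 * K * (u s - m) = (2 * √(u s - m)) ^ 2 *
      (√(u s - m) ^ 4 + 3 * m * √(u s - m) ^ 2 + 3 * m ^ 2 + K / 2) := by
    rw [mul_pow, h4, hw]; ring
  rw [key, Real.sqrt_mul (by positivity), Real.sqrt_sq (by positivity), timeDensity]
  field_simp

lemma continuousOn_passageTime_sqrt_sub (hK : 0 < K) (m : ℝ)
    (hu : ∀ s ∈ Icc a b, HasDerivAt u (p s) s) :
    ContinuousOn (fun s => passageTime m K √(u s - m)) (Icc a b) := by
  have hG : Continuous (passageTime m K) :=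
    continuous_iff_continuousAt.2 fun w => (hasDerivAt_passageTime m w hK).continuousAt
  have hc : ContinuousOn u (Icc a b) := fun s hs => (hu s hs).continuousAt.continuousWithinAt
  exact hG.comp_continuousOn (hc.sub continuousOn_const).sqrt

lemma potential_pos {m y : ℝ} (hK : 0 < K) (hm : m < y) :
    0 < 4 * (y ^ 3 - m ^ 3) + 2 * K * (y - m) := by
  have h1 : m ^ 3 < y ^ 3 := Odd.strictMono_pow (by decide) hm
  have h2 : 0 < K * (y - m) := mul_pos hK (sub_pos.2 hm)
  linarith

/-- A solution of `u'' = 6u² + f` with `f ≥ K` ascends at least as fast as the solution of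
`u'' = 6u² + K` started at rest. -/
lemma sub_le_passageTime (hK : 0 < K) (hab : a ≤ b)
    (hu : ∀ s ∈ Icc a b, HasDerivAt u (p s) s)
    (hp : ∀ s ∈ Icc a b, HasDerivAt p (6 * u s ^ 2 + f s) s)
    (hpa : 0 ≤ p a) (hfK : ∀ s ∈ Icc a b, K ≤ f s) :
    b - a ≤ passageTime (u a) K √(u b - u a) := by
  have hf : ∀ s ∈ Icc a b, 0 < f s := fun s hs => hK.trans_le (hfK s hs)
  have hmono : MonotoneOn (fun s => passageTime (u a) K √(u s - u a) - s) (Icc a b) := by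
    have hd : ∀ s ∈ interior (Icc a b),
        HasDerivAt (fun s => passageTime (u a) K √(u s - u a) - s)
          (p s / √(4 * (u s ^ 3 - u a ^ 3) + 2 * K * (u s - u a)) - 1) s := fun s hs => by
      have hs' := interior_subset hs
      rw [interior_Icc] at hs
      exact (hasDerivAt_passageTime_sqrt_sub hK (hu s hs') (deriv_pos_and_lt_of_forcing_pos
        hu hp hf hpa (Ioo_subset_Ioc_self hs)).2).sub (hasDerivAt_id s)
    refine monotoneOn_of_deriv_nonneg (convex_Icc a b)
      ((continuousOn_passageTime_sqrt_sub hK _ hu).sub continuousOn_id)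
      (fun s hs => (hd s hs).differentiableAt.differentiableWithinAt) fun s hs => ?_
    rw [(hd s hs).deriv]
    have hs' := interior_subset hs
    rw [interior_Icc] at hs
    have h1 := deriv_pos_and_lt_of_forcing_pos hu hp hf hpa (Ioo_subset_Ioc_self hs)
    have hV := potential_pos hK h1.2
    rw [sub_nonneg, one_le_div (Real.sqrt_pos.2 hV)]
    apply Real.sqrt_le_iff.2 ⟨h1.1.le, ?_⟩
    have := energy_le_energy hu hp hf hpa hfK (u a) hs'
    simp only [energy] at this
    nlinarith [sq_nonneg (p a)]
  have := hmono (left_mem_Icc.2 hab) (right_mem_Icc.2 hab) hab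
  simp only [sub_self, Real.sqrt_zero, passageTime, intervalIntegral.integral_same] at this
  simp only [passageTime]
  linarith

/-- A solution of `u'' = 6u² + f` with `0 < f ≤ K`, started at rest, ascends at most as fast as
the solution of `u'' = 6u² + K`. -/
lemma passageTime_le_sub (hab : a ≤ b)
    (hu : ∀ s ∈ Icc a b, HasDerivAt u (p s) s)
    (hp : ∀ s ∈ Icc a b, HasDerivAt p (6 * u s ^ 2 + f s) s)
    (hpa : p a = 0) (hf : ∀ s ∈ Icc a b, 0 < f s) (hfK : ∀ s ∈ Icc a b, f s ≤ K) :
    passageTime (u a) K √(u b - u a) ≤ b - a := by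
  have hK : 0 < K := (hf a (left_mem_Icc.2 hab)).trans_le (hfK a (left_mem_Icc.2 hab))
  have hanti : AntitoneOn (fun s => passageTime (u a) K √(u s - u a) - s) (Icc a b) := by
    have hd : ∀ s ∈ interior (Icc a b),
        HasDerivAt (fun s => passageTime (u a) K √(u s - u a) - s)
          (p s / √(4 * (u s ^ 3 - u a ^ 3) + 2 * K * (u s - u a)) - 1) s := fun s hs => by
      have hs' := interior_subset hs
      rw [interior_Icc] at hs
      exact (hasDerivAt_passageTime_sqrt_sub hK (hu s hs') (deriv_pos_and_lt_of_forcing_pos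
        hu hp hf hpa.ge (Ioo_subset_Ioc_self hs)).2).sub (hasDerivAt_id s)
    refine antitoneOn_of_deriv_nonpos (convex_Icc a b)
      ((continuousOn_passageTime_sqrt_sub hK _ hu).sub continuousOn_id)
      (fun s hs => (hd s hs).differentiableAt.differentiableWithinAt) fun s hs => ?_
    rw [(hd s hs).deriv]
    have hs' := interior_subset hs
    rw [interior_Icc] at hs
    have h1 := deriv_pos_and_lt_of_forcing_pos hu hp hf hpa.ge (Ioo_subset_Ioc_self hs)
    have hV := potential_pos hK h1.2
    rw [sub_nonpos, div_le_one (Real.sqrt_pos.2 hV)]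
    apply Real.le_sqrt_of_sq_le
    have := energy_le_energy_of_forcing_le hu hp hf hpa.ge hfK (u a) hs'
    simp only [energy, hpa] at this
    linarith
  have := hanti (left_mem_Icc.2 hab) (right_mem_Icc.2 hab) hab
  simp only [sub_self, Real.sqrt_zero, passageTime, intervalIntegral.integral_same] at this
  simp only [passageTime]
  linarith

end Comparison

/-- `u`, with derivative `p`, solves `u'' = 6u² + σ s` on `I`. For `σ = 1` this is the first
Painlevé equation in the variable `s = -x`, for `σ = -1` in the variable `x`. -/
def IsSolution (σ : ℝ) (u p : ℝ → ℝ) (I : Set ℝ) : Prop :=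
  ∀ s ∈ I, HasDerivAt u (p s) s ∧ HasDerivAt p (6 * u s ^ 2 + σ * s) s

lemma IsSolution.mono {σ : ℝ} {u p : ℝ → ℝ} {I J : Set ℝ} (h : IsSolution σ u p J)
    (hI : I ⊆ J) : IsSolution σ u p I := fun s hs => h s (hI hs)

lemma IsSolution.reflect {σ : ℝ} {u p : ℝ → ℝ} {I J : Set ℝ} (h : IsSolution σ u p J)
    (hI : ∀ s ∈ I, -s ∈ J) : IsSolution (-σ) (fun s => u (-s)) (fun s => -p (-s)) I := by
  intro s hs
  obtain ⟨hu, hp⟩ := h (-s) (hI s hs)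
  refine ⟨?_, ?_⟩
  · exact (hu.comp s (hasDerivAt_neg s)).congr_deriv (by ring)
  · exact ((hp.comp s (hasDerivAt_neg s)).neg).congr_deriv (by ring)

lemma rpow_quarter_pow {K : ℝ} (hK : 0 < K) : (K ^ ((1:ℝ) / 4)) ^ 4 = K := by
  rw [← Real.rpow_natCast, ← Real.rpow_mul hK.le]
  norm_num

lemma ascent_time_le {u p f : ℝ → ℝ} {a b K : ℝ} (hK : 0 < K) (hab : a ≤ b)
    (hu : ∀ s ∈ Icc a b, HasDerivAt u (p s) s)
    (hp : ∀ s ∈ Icc a b, HasDerivAt p (6 * u s ^ 2 + f s) s)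
    (hpa : 0 ≤ p a) (hfK : ∀ s ∈ Icc a b, K ≤ f s) :
    b - a ≤ painleveC / K ^ ((1:ℝ) / 4) := by
  have hl : 0 < K ^ ((1:ℝ) / 4) := Real.rpow_pos_of_pos hK _
  have h1 := sub_le_passageTime hK hab hu hp hpa hfK
  have h2 := passageTime_le (u a) √(u b - u a) hl
  rw [rpow_quarter_pow hK] at h2
  refine h1.trans (h2.trans ?_)
  gcongr
  exact blowupTime_le _

lemma IsSolution.exists_le_add {u p : ℝ → ℝ} {k R : ℝ} (hk : 0 < k) (hkR : k ≤ R)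
    (h : IsSolution 1 u p (Icc k R)) :
    ∃ m ∈ Icc 0 (painleveC / k ^ ((1:ℝ) / 4)),
      R - k ≤ m + painleveC / (k + m) ^ ((1:ℝ) / 4) := by
  have hC := painleveC_pos
  have key : ∀ c ∈ Icc k R, (c = k ∨ p c ≤ 0) → (c = R ∨ 0 ≤ p c) →
      ∃ m ∈ Icc 0 (painleveC / k ^ ((1:ℝ) / 4)),
      R - k ≤ m + painleveC / (k + m) ^ ((1:ℝ) / 4) := by
    intro c hc hdesc hasc
    refine ⟨c - k, ⟨sub_nonneg.2 hc.1, ?_⟩, ?_⟩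
    · rcases hdesc with rfl | hpc
      · rw [sub_self]
        positivity
      · have h' : IsSolution (-1) (fun s => u (-s)) (fun s => -p (-s)) (Icc (-c) (-k)) :=
          h.reflect fun s hs => ⟨by linarith [hs.2], by linarith [hs.1, hc.2]⟩
        have := ascent_time_le hk (neg_le_neg hc.1) (fun s hs => (h' s hs).1)
          (fun s hs => (h' s hs).2) (by simpa using hpc) fun s hs => by linarith [hs.2]
        linarith
    · rcases hasc with rfl | hpc
      · have : 0 < painleveC / (k + (c - k)) ^ ((1:ℝ) / 4) := by
          rw [add_sub_cancel]
          have : 0 < c := hk.trans_le hkR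
          positivity
        linarith
      · have hc0 : 0 < c := hk.trans_le hc.1
        have h' := h.mono (Icc_subset_Icc_left hc.1)
        have := ascent_time_le hc0 hc.2 (fun s hs => (h' s hs).1)
          (fun s hs => (h' s hs).2) hpc fun s hs => by linarith [hs.1]
        rw [add_sub_cancel]
        linarith
  rcases le_or_gt 0 (p k) with h0 | h0
  · exact key k (left_mem_Icc.2 hkR) (Or.inl rfl) (Or.inr h0)
  rcases le_or_gt (p R) 0 with h1 | h1
  · exact key R (right_mem_Icc.2 hkR) (Or.inr h1) (Or.inl rfl)
  · have hc : ContinuousOn p (Icc k R) := fun s hs => (h s hs).2.continuousAt.continuousWithinAt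
    obtain ⟨c, hc, hpc⟩ := intermediate_value_Icc hkR hc ⟨h0.le, h1.le⟩
    exact key c hc (Or.inr hpc.le) (Or.inr hpc.ge)

/-- The interval of existence to the left of `x = -k` has length uniformly less than
`2C / k^{1/4}`. -/
lemma exists_uniform_length_bound {k : ℝ} (hk : 0 < k) :
    ∃ B < 2 * painleveC / k ^ ((1:ℝ) / 4), ∀ (u p : ℝ → ℝ) (R : ℝ), k ≤ R →
      IsSolution 1 u p (Icc k R) → R - k ≤ B := by
  have hC := painleveC_pos
  set S := painleveC / k ^ ((1:ℝ) / 4) with hS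
  have hS0 : 0 < S := by positivity
  have hcont : ContinuousOn (fun m => m + painleveC / (k + m) ^ ((1:ℝ) / 4)) (Icc 0 S) := by
    refine continuousOn_id.add (continuousOn_const.div ?_ fun m hm => ?_)
    · exact (continuousOn_const.add continuousOn_id).rpow_const fun m hm => Or.inr (by norm_num)
    · have : 0 < k + m := by linarith [hm.1]
      positivity
  obtain ⟨m, hm, hmax⟩ := isCompact_Icc.exists_isMaxOn (nonempty_Icc.2 hS0.le) hcont
  refine ⟨m + painleveC / (k + m) ^ ((1:ℝ) / 4), ?_, fun u p R hkR h => ?_⟩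
  · have h2S : 2 * painleveC / k ^ ((1:ℝ) / 4) = S + S := by rw [hS]; ring
    rw [h2S]
    rcases hm.2.lt_or_eq with hlt | heq
    · have : painleveC / (k + m) ^ ((1:ℝ) / 4) ≤ S := by
        rw [hS]
        gcongr
        linarith [hm.1]
      linarith
    · have : painleveC / (k + m) ^ ((1:ℝ) / 4) < S := by
        rw [hS]
        gcongr
        linarith
      linarith
  · obtain ⟨m', hm', hle⟩ := h.exists_le_add hk hkR
    exact hle.trans (hmax hm')

lemma IsSolution.length_le {u p : ℝ → ℝ} {k R : ℝ} (hk : 0 ≤ k)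
    (h : IsSolution 1 u p (Icc k R)) : R ≤ k + 1 + 2 * painleveC := by
  have hC := painleveC_pos
  rcases lt_or_ge R (k + 1) with hR | hR
  · linarith
  obtain ⟨B, hB, hlen⟩ := exists_uniform_length_bound (k := k + 1) (by linarith)
  have h1 := hlen u p R hR (h.mono (Icc_subset_Icc_left (by linarith)))
  have h2 : 2 * painleveC / (k + 1) ^ ((1:ℝ) / 4) ≤ 2 * painleveC :=
    div_le_self (by positivity) (Real.one_le_rpow (by linarith) (by norm_num))
  linarith

section AutonomousODE

variable {E : Type*} [NormedAddCommGroup E] [NormedSpace ℝ E] {v : E → E}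

lemma eqOn_Ioo_of_contDiff (hv : ContDiff ℝ 1 v) {γ η : ℝ → E} {a b c : ℝ} (hc : c ∈ Ioo a b)
    (hγ : ∀ t ∈ Ioo a b, HasDerivAt γ (v (γ t)) t)
    (hη : ∀ t ∈ Ioo a b, HasDerivAt η (v (η t)) t) (heq : γ c = η c) :
    EqOn γ η (Ioo a b) := by
  intro t ht
  obtain ⟨lo, hlo, hlo'⟩ := exists_between (lt_min hc.1 ht.1)
  obtain ⟨hi, hhi, hhi'⟩ := exists_between (max_lt hc.2 ht.2)
  rw [lt_min_iff] at hlo'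
  rw [max_lt_iff] at hhi
  have hsub : Icc lo hi ⊆ Ioo a b := Icc_subset_Ioo hlo hhi'
  have hγc : ContinuousOn γ (Icc lo hi) := fun s hs =>
    (hγ s (hsub hs)).continuousAt.continuousWithinAt
  have hηc : ContinuousOn η (Icc lo hi) := fun s hs =>
    (hη s (hsub hs)).continuousAt.continuousWithinAt
  have hcomp : IsCompact (γ '' Icc lo hi ∪ η '' Icc lo hi) :=
    (isCompact_Icc.image_of_continuousOn hγc).union (isCompact_Icc.image_of_continuousOn hηc)
  obtain ⟨K, hK⟩ := (hv.locallyLipschitz.locallyLipschitzOn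
    (s := γ '' Icc lo hi ∪ η '' Icc lo hi)).exists_lipschitzOnWith_of_compact hcomp
  refine ODE_solution_unique_of_mem_Icc (v := fun _ => v)
    (s := fun _ => γ '' Icc lo hi ∪ η '' Icc lo hi) (fun _ _ => hK) ⟨hlo'.1, hhi.1⟩
    hγc (fun s hs => hγ s (hsub (Ioo_subset_Icc_self hs)))
    (fun s hs => Or.inl ⟨s, Ioo_subset_Icc_self hs, rfl⟩)
    hηc (fun s hs => hη s (hsub (Ioo_subset_Icc_self hs)))
    (fun s hs => Or.inr ⟨s, Ioo_subset_Icc_self hs, rfl⟩) heq ⟨hlo'.2.le, hhi.2.le⟩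

/-- Gluing two integral curves that agree at a common time. -/
lemma exists_integralCurve_Ioo_union (hv : ContDiff ℝ 1 v) {γ η : ℝ → E} {a b a' b' c : ℝ}
    (hγ : ∀ t ∈ Ioo a b, HasDerivAt γ (v (γ t)) t)
    (hη : ∀ t ∈ Ioo a' b', HasDerivAt η (v (η t)) t)
    (hc : c ∈ Ioo a b) (hc' : c ∈ Ioo a' b') (heq : γ c = η c) :
    ∃ ζ : ℝ → E, EqOn ζ γ (Ioo a b) ∧ ∀ t ∈ Ioo a b', HasDerivAt ζ (v (ζ t)) t := by
  classical
  set ζ : ℝ → E := fun t => if t < b then γ t else η t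
  have hζγ : EqOn ζ γ (Ioo a b) := fun t ht => if_pos ht.2
  have hagree : EqOn γ η (Ioo (max a a') (min b b')) :=
    eqOn_Ioo_of_contDiff hv ⟨max_lt hc.1 hc'.1, lt_min hc.2 hc'.2⟩
      (fun t ht => hγ t ⟨(le_max_left _ _).trans_lt ht.1, ht.2.trans_le (min_le_left _ _)⟩)
      (fun t ht => hη t ⟨(le_max_right _ _).trans_lt ht.1, ht.2.trans_le (min_le_right _ _)⟩) heq
  have hζη : EqOn ζ η (Ioo (max a a') b') := by
    intro t ht
    by_cases htb : t < b
    · exact (if_pos htb).trans (hagree ⟨ht.1, lt_min htb ht.2⟩)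
    · exact if_neg htb
  refine ⟨ζ, hζγ, fun t ht => ?_⟩
  by_cases htb : t < b
  · have hmem : t ∈ Ioo a b := ⟨ht.1, htb⟩
    rw [hζγ hmem]
    exact (hγ t hmem).congr_of_eventuallyEq (hζγ.eventuallyEq_of_mem (isOpen_Ioo.mem_nhds hmem))
  · have hct : c < t := hc.2.trans_le (not_lt.1 htb)
    have hmem : t ∈ Ioo (max a a') b' := ⟨(max_lt hc.1 hc'.1).trans hct, ht.2⟩
    rw [hζη hmem]
    exact (hη t ⟨(le_max_right _ _).trans_lt hmem.1, ht.2⟩).congr_of_eventuallyEq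
      (hζη.eventuallyEq_of_mem (isOpen_Ioo.mem_nhds hmem))

variable [CompleteSpace E]

lemma exists_uniform_time_on_isCompact (hv : ContDiff ℝ 1 v) {K : Set E} (hK : IsCompact K) :
    ∃ ε > 0, ∀ x ∈ K, ∀ t₀ : ℝ, ∃ γ : ℝ → E, γ t₀ = x ∧
      ∀ t ∈ Ioo (t₀ - ε) (t₀ + ε), HasDerivAt γ (v (γ t)) t := by
  refine hK.induction_on (p := fun S => ∃ ε > (0:ℝ), ∀ x ∈ S, ∀ t₀ : ℝ, ∃ γ : ℝ → E, γ t₀ = x ∧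
      ∀ t ∈ Ioo (t₀ - ε) (t₀ + ε), HasDerivAt γ (v (γ t)) t) ⟨1, one_pos, by simp⟩ ?_ ?_ ?_
  · rintro S T hST ⟨ε, hε, h⟩
    exact ⟨ε, hε, fun x hx => h x (hST hx)⟩
  · rintro S T ⟨ε, hε, h⟩ ⟨ε', hε', h'⟩
    refine ⟨min ε ε', lt_min hε hε', ?_⟩
    rintro x (hx | hx) t₀
    · obtain ⟨γ, h1, h2⟩ := h x hx t₀
      exact ⟨γ, h1, fun t ht => h2 t (Ioo_subset_Ioo
        (sub_le_sub_left (min_le_left _ _) _) (add_le_add_right (min_le_left _ _) _) ht)⟩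
    · obtain ⟨γ, h1, h2⟩ := h' x hx t₀
      exact ⟨γ, h1, fun t ht => h2 t (Ioo_subset_Ioo
        (sub_le_sub_left (min_le_right _ _) _) (add_le_add_right (min_le_right _ _) _) ht)⟩
  · intro x _
    obtain ⟨r, hr, ε, hε, h⟩ :=
      hv.contDiffAt.exists_forall_mem_closedBall_exists_eq_forall_mem_Ioo_hasDerivAt (x₀ := x) 0
    refine ⟨_, mem_nhdsWithin_of_mem_nhds (Metric.closedBall_mem_nhds x hr), ε, hε,
      fun y hy t₀ => ?_⟩
    obtain ⟨γ, h1, h2⟩ := h y hy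
    refine ⟨fun t => γ (t - t₀), by simpa using h1, fun t ht => ?_⟩
    have := h2 (t - t₀) ⟨by linarith [ht.1], by linarith [ht.2]⟩
    simpa using this.comp_sub_const t t₀

/-- An integral curve either extends to all later times or leaves every compact set in finite
time. -/
theorem exists_maximal_integralCurve (hv : ContDiff ℝ 1 v) {γ₀ : ℝ → E} {a b c : ℝ}
    (hc : c ∈ Ioo a b) (hγ₀ : ∀ t ∈ Ioo a b, HasDerivAt γ₀ (v (γ₀ t)) t) :
    (∀ R, ∃ γ : ℝ → E, γ c = γ₀ c ∧ ∀ t ∈ Ioo a R, HasDerivAt γ (v (γ t)) t) ∨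
    ∃ T ≥ b, ∃ γ : ℝ → E, γ c = γ₀ c ∧ (∀ t ∈ Ioo a T, HasDerivAt γ (v (γ t)) t) ∧
      ∀ K, IsCompact K → ∃ t ∈ Ico c T, γ t ∉ K := by
  set S : Set ℝ := {R | ∃ γ : ℝ → E, γ c = γ₀ c ∧ ∀ t ∈ Ioo a R, HasDerivAt γ (v (γ t)) t}
    with hS
  have hbS : b ∈ S := ⟨γ₀, rfl, hγ₀⟩
  by_cases hbdd : BddAbove S
  · right
    set T := sSup S
    have hbT : b ≤ T := le_csSup hbdd hbS
    have hcT : c < T := hc.2.trans_le hbT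
    choose! g hgc hg using (fun R (hR : R ∈ S) => hR)
    have hex : ∀ t, ∃ R, t < T → R ∈ S ∧ t < R ∧ c < R := by
      intro t
      by_cases ht : t < T
      · obtain ⟨R, hR, h⟩ := exists_lt_of_lt_csSup ⟨b, hbS⟩ (max_lt ht hcT)
        exact ⟨R, fun _ => ⟨hR, (le_max_left _ _).trans_lt h, (le_max_right _ _).trans_lt h⟩⟩
      · exact ⟨0, fun h => absurd h ht⟩
    choose r hr using hex
    have hagree : ∀ R ∈ S, c < R → ∀ t ∈ Ioo a T, t < R → g (r t) t = g R t := by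
      intro R hR hcR t ht htR
      obtain ⟨h1, h2, h3⟩ := hr t ht.2
      exact eqOn_Ioo_of_contDiff hv (a := a) (b := min (r t) R) (c := c)
        ⟨hc.1, lt_min h3 hcR⟩
        (fun s hs => hg _ h1 s ⟨hs.1, hs.2.trans_le (min_le_left _ _)⟩)
        (fun s hs => hg _ hR s ⟨hs.1, hs.2.trans_le (min_le_right _ _)⟩)
        ((hgc _ h1).trans (hgc _ hR).symm) ⟨ht.1, lt_min h2 htR⟩
    have hsol : ∀ t ∈ Ioo a T, HasDerivAt (fun t => g (r t) t) (v (g (r t) t)) t := by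
      intro t ht
      obtain ⟨h1, h2, h3⟩ := hr t ht.2
      refine (hg _ h1 t ⟨ht.1, h2⟩).congr_of_eventuallyEq ?_
      filter_upwards [Ioo_mem_nhds ht.1 (lt_min h2 ht.2)] with s hs
      exact hagree _ h1 h3 s ⟨hs.1, hs.2.trans_le (min_le_right _ _)⟩
        (hs.2.trans_le (min_le_left _ _))
    have hinit : g (r c) c = γ₀ c := hgc _ (hr c hcT).1
    refine ⟨T, hbT, fun t => g (r t) t, hinit, hsol, ?_⟩
    intro K hK
    by_contra! hstay
    obtain ⟨ε, hε, hloc⟩ := exists_uniform_time_on_isCompact hv hK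
    obtain ⟨t₀, ht₀, ht₀T⟩ := exists_between (max_lt hcT (sub_lt_self T hε))
    rw [max_lt_iff] at ht₀
    obtain ⟨η, hη₀, hη⟩ := hloc _ (hstay t₀ ⟨ht₀.1.le, ht₀T⟩) t₀
    obtain ⟨ζ, hζ, hζsol⟩ := exists_integralCurve_Ioo_union hv hsol hη
      ⟨hc.1.trans ht₀.1, ht₀T⟩ ⟨by linarith, by linarith⟩ hη₀.symm
    have : t₀ + ε ∈ S := ⟨ζ, (hζ ⟨hc.1, hcT⟩).trans hinit, hζsol⟩
    linarith [le_csSup hbdd this]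
  · left
    intro R
    obtain ⟨R', ⟨γ, h1, h2⟩, hR'⟩ := not_bddAbove_iff.1 hbdd R
    exact ⟨γ, h1, fun t ht => h2 t ⟨ht.1, ht.2.trans hR'⟩⟩

end AutonomousODE

/-- The autonomous vector field of `u'' = 6u² + σ s` in the variables `(s, u, u')`. -/
def painleveField (σ : ℝ) (z : ℝ × ℝ × ℝ) : ℝ × ℝ × ℝ :=
  (1, z.2.2, 6 * z.2.1 ^ 2 + σ * z.1)

lemma contDiff_painleveField (σ : ℝ) : ContDiff ℝ 1 (painleveField σ) := by
  unfold painleveField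
  fun_prop

lemma isSolution_of_integralCurve {σ a b c : ℝ} {γ : ℝ → ℝ × ℝ × ℝ} (hc : c ∈ Ioo a b)
    (hγ : ∀ t ∈ Ioo a b, HasDerivAt γ (painleveField σ (γ t)) t) (hγc : (γ c).1 = c) :
    IsSolution σ (fun s => (γ s).2.1) (fun s => (γ s).2.2) (Ioo a b) := by
  have h1 : EqOn (fun t => (γ t).1) id (Ioo a b) :=
    eqOn_Ioo_of_contDiff (v := fun _ => (1:ℝ)) contDiff_const hc (fun t ht => (hγ t ht).fst)
      (fun t _ => hasDerivAt_id t) hγc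
  intro s hs
  have hp : HasDerivAt (fun s => (γ s).2.2) (painleveField σ (γ s)).2.2 s := (hγ s hs).snd.snd
  refine ⟨(hγ s hs).snd.fst, hp.congr_deriv ?_⟩
  have : (γ s).1 = s := h1 hs
  simp only [painleveField, this]

lemma exists_local_solution (σ c u₀ p₀ : ℝ) :
    ∃ δ > 0, ∃ u p : ℝ → ℝ, u c = u₀ ∧ p c = p₀ ∧ IsSolution σ u p (Ioo (c - δ) (c + δ)) := by
  obtain ⟨γ, hγc, δ, hδ, hγ⟩ := (contDiff_painleveField σ).contDiffAt
    |>.exists_forall_mem_closedBall_exists_eq_forall_mem_Ioo_hasDerivAt₀ (x₀ := (c, u₀, p₀)) c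
  exact ⟨δ, hδ, _, _, by rw [hγc], by rw [hγc], isSolution_of_integralCurve
    (c := c) ⟨by linarith, by linarith⟩ hγ (by rw [hγc])⟩

lemma IsSolution.exists_maximal {σ a b c : ℝ} {u p : ℝ → ℝ} (hc : c ∈ Ioo a b)
    (h : IsSolution σ u p (Ioo a b)) :
    (∀ R, ∃ u' p' : ℝ → ℝ, u' c = u c ∧ p' c = p c ∧ IsSolution σ u' p' (Ioo a R)) ∨
    ∃ T ≥ b, ∃ u' p' : ℝ → ℝ, u' c = u c ∧ p' c = p c ∧ IsSolution σ u' p' (Ioo a T) ∧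
      ∀ M, ∃ t ∈ Ico c T, M < |u' t| ∨ M < |p' t| := by
  have hcurve : ∀ t ∈ Ioo a b,
      HasDerivAt (fun s => (s, u s, p s)) (painleveField σ (t, u t, p t)) t := fun t ht =>
    (hasDerivAt_id t).prodMk ((h t ht).1.prodMk (h t ht).2)
  rcases exists_maximal_integralCurve (contDiff_painleveField σ) hc hcurve with hall | hex
  · left
    intro R
    obtain ⟨γ, hγc, hγ⟩ := hall (max R (c + 1))
    exact ⟨_, _, by rw [hγc], by rw [hγc],
      (isSolution_of_integralCurve ⟨hc.1, (lt_add_one c).trans_le (le_max_right _ _)⟩ hγ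
        (by rw [hγc])).mono (Ioo_subset_Ioo_right (le_max_left _ _))⟩
  · right
    obtain ⟨T, hT, γ, hγc, hγ, hleave⟩ := hex
    have hcT : c < T := hc.2.trans_le hT
    have hsol := isSolution_of_integralCurve ⟨hc.1, hcT⟩ hγ (by rw [hγc])
    refine ⟨T, hT, _, _, by rw [hγc], by rw [hγc], hsol, fun M => ?_⟩
    obtain ⟨t, ht, hnot⟩ := hleave (Icc c T ×ˢ Icc (-M) M ×ˢ Icc (-M) M)
      (isCompact_Icc.prod (isCompact_Icc.prod isCompact_Icc))
    refine ⟨t, ht, ?_⟩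
    by_contra! hM
    have h1 : (γ t).1 = t :=
      eqOn_Ioo_of_contDiff (v := fun _ => (1:ℝ)) (γ := fun t => (γ t).1) (η := id) contDiff_const
        ⟨hc.1, hcT⟩ (fun t ht => (hγ t ht).fst) (fun t _ => hasDerivAt_id t)
        (by simp [hγc]) ⟨hc.1.trans_le ht.1, ht.2⟩
    exact hnot ⟨by rw [h1]; exact Ico_subset_Icc_self ht, abs_le.1 hM.1, abs_le.1 hM.2⟩

lemma abs_le_of_abs_deriv_le {g g' : ℝ → ℝ} {c T M : ℝ} (hM : 0 ≤ M)
    (hg : ∀ s ∈ Ico c T, HasDerivAt g (g' s) s) (hg' : ∀ s ∈ Ico c T, |g' s| ≤ M)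
    {t : ℝ} (ht : t ∈ Ico c T) : |g t| ≤ |g c| + M * (T - c) := by
  have h := (convex_Ico c T).norm_image_sub_le_of_norm_hasDerivWithin_le
    (fun s hs => (hg s hs).hasDerivWithinAt) hg' (left_mem_Ico.2 (ht.1.trans_lt ht.2)) ht
  rw [Real.norm_eq_abs, Real.norm_eq_abs, abs_of_nonneg (sub_nonneg.2 ht.1)] at h
  have h2 : M * (t - c) ≤ M * (T - c) := by gcongr; exact ht.2.le
  have h3 := abs_sub_abs_le_abs_sub (g t) (g c)
  linarith

/-- Unbounded solutions of `u'' = 6u² + s` tend to `+∞`. -/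
lemma IsSolution.tendsto_atTop {c T : ℝ} {u p : ℝ → ℝ} (hc : 0 ≤ c) (hcT : c < T)
    (h : IsSolution 1 u p (Ico c T)) (hM : ∀ M, ∃ t ∈ Ico c T, M < |u t| ∨ M < |p t|) :
    Tendsto u (𝓝[<] T) atTop := by
  have hpmono : MonotoneOn p (Ico c T) := by
    refine monotoneOn_of_deriv_nonneg (convex_Ico c T)
      (fun s hs => (h s hs).2.continuousAt.continuousWithinAt)
      (fun s hs => (h s (interior_subset hs)).2.differentiableAt.differentiableWithinAt)
      fun s hs => ?_
    have hs' := interior_subset hs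
    rw [(h s hs').2.deriv]
    nlinarith [sq_nonneg (u s), hs'.1]
  have hunb : ∀ M, ∃ t ∈ Ico c T, M < |u t| := by
    by_contra! ⟨M, hub⟩
    have hM0 : 0 ≤ M := (abs_nonneg _).trans (hub c (left_mem_Ico.2 hcT))
    have hp'b : ∀ s ∈ Ico c T, |6 * u s ^ 2 + 1 * s| ≤ 6 * M ^ 2 + T := fun s hs => by
      have h1 : u s ^ 2 ≤ M ^ 2 := sq_le_sq' (abs_le.1 (hub s hs)).1 (abs_le.1 (hub s hs)).2
      rw [abs_of_nonneg (by nlinarith [sq_nonneg (u s), hs.1])]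
      linarith [hs.2]
    have hT0 : 0 ≤ T := hc.trans hcT.le
    obtain ⟨t, ht, hbig⟩ := hM (max M (|p c| + (6 * M ^ 2 + T) * (T - c)))
    rcases hbig with hbig | hbig
    · exact absurd (hub t ht) (not_le.2 ((le_max_left _ _).trans_lt hbig))
    · exact absurd (abs_le_of_abs_deriv_le (by positivity) (fun s hs => (h s hs).2) hp'b ht)
        (not_le.2 ((le_max_right _ _).trans_lt hbig))
  have hp1 : ∃ s₁ ∈ Ico c T, 0 < p s₁ := by
    by_contra! hp0
    have hpb : ∀ s ∈ Ico c T, |p s| ≤ |p c| := fun s hs => by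
      have hsc := hpmono (left_mem_Ico.2 hcT) hs hs.1
      rw [abs_of_nonpos (hp0 s hs), abs_of_nonpos (hp0 c (left_mem_Ico.2 hcT))]
      linarith
    obtain ⟨t, ht, hbig⟩ := hunb (|u c| + |p c| * (T - c))
    exact absurd (abs_le_of_abs_deriv_le (abs_nonneg _) (fun s hs => (h s hs).1) hpb ht)
      (not_le.2 hbig)
  obtain ⟨s₁, hs₁, hps₁⟩ := hp1
  have hsub : Ico s₁ T ⊆ Ico c T := Ico_subset_Ico_left hs₁.1
  have humono : MonotoneOn u (Ico s₁ T) := by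
    refine monotoneOn_of_deriv_nonneg (convex_Ico s₁ T)
      (fun s hs => (h s (hsub hs)).1.continuousAt.continuousWithinAt)
      (fun s hs => (h s (hsub (interior_subset hs))).1.differentiableAt.differentiableWithinAt)
      fun s hs => ?_
    have hs' := interior_subset hs
    rw [(h s (hsub hs')).1.deriv]
    exact hps₁.le.trans (hpmono hs₁ (hsub hs') hs'.1)
  obtain ⟨B, hB⟩ := (isCompact_Icc (a := c) (b := s₁)).exists_bound_of_continuousOn
    fun s (hs : s ∈ Icc c s₁) =>
      (h s ⟨hs.1, hs.2.trans_lt hs₁.2⟩).1.continuousAt.continuousWithinAt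
  refine Filter.tendsto_atTop.2 fun N => ?_
  obtain ⟨t, ht, hbig⟩ := hunb (max B (max |N| |u s₁|))
  rw [max_lt_iff, max_lt_iff] at hbig
  have hst : s₁ < t := by
    by_contra! hts
    exact absurd (hB t ⟨ht.1, hts⟩) (not_le.2 hbig.1)
  have hut : u s₁ ≤ u t := humono ⟨le_rfl, hs₁.2⟩ ⟨hst.le, ht.2⟩ hst.le
  have hNu : N ≤ u t := by
    have h1 : |u t| = u t := by
      refine abs_of_nonneg ?_
      by_contra! hneg
      have h2 := hbig.2.2
      rw [abs_of_neg hneg, abs_of_neg (hut.trans_lt hneg)] at h2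
      linarith
    linarith [le_abs_self N, hbig.2.1]
  filter_upwards [Ioo_mem_nhdsLT ht.2] with s hs
  exact hNu.trans (humono ⟨hst.le, ht.2⟩ ⟨hst.le.trans hs.1.le, hs.2⟩ hs.1.le)

/-- Every solution of `u'' = 6u² + s` tends to `+∞` at a finite time. -/
lemma IsSolution.exists_blowup {a b c : ℝ} {u p : ℝ → ℝ} (hc0 : 0 ≤ c) (hc : c ∈ Ioo a b)
    (h : IsSolution 1 u p (Ioo a b)) :
    ∃ T ≥ b, ∃ u' p' : ℝ → ℝ, u' c = u c ∧ p' c = p c ∧ IsSolution 1 u' p' (Ioo a T) ∧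
      Tendsto u' (𝓝[<] T) atTop := by
  rcases h.exists_maximal hc with hall | ⟨T, hT, u', p', hu', hp', hsol, hM⟩
  · exfalso
    obtain ⟨u', p', -, -, hsol⟩ := hall (c + 3 + 2 * painleveC)
    have := (hsol.mono (Icc_subset_Ioo (a₁ := c) (b₁ := c + 2 + 2 * painleveC) hc.1
      (by linarith))).length_le hc0
    linarith
  · exact ⟨T, hT, u', p', hu', hp', hsol,
      (hsol.mono (Ico_subset_Ioo_left hc.1)).tendsto_atTop hc0 (hc.2.trans_le hT) hM⟩

/-- The left endpoints of the intervals of existence of the solutions of `y'' = 6y² - x` that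
are regular at `x₀`. -/
def leftBlowupPoints (x₀ : ℝ) : Set ℝ :=
  {a : ℝ | ∃ y y' : ℝ → ℝ, a < x₀ ∧
    (∀ x ∈ Set.Ioc a x₀,
      HasDerivAt y (y' x) x ∧ HasDerivAt y' (6 * (y x) ^ 2 - x) x) ∧
    Tendsto y (𝓝[>] a) atTop}

lemma neg_mem_leftBlowupPoints {u p : ℝ → ℝ} {a T k : ℝ} (hk : k ∈ Ioo a T)
    (h : IsSolution 1 u p (Ioo a T)) (hT : Tendsto u (𝓝[<] T) atTop) :
    -T ∈ leftBlowupPoints (-k) := by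
  have hr : IsSolution (-1) (fun s => u (-s)) (fun s => -p (-s)) (Ioc (-T) (-k)) :=
    h.reflect fun s hs => ⟨by linarith [hs.2, hk.1], by linarith [hs.1]⟩
  refine ⟨fun s => u (-s), fun s => -p (-s), neg_lt_neg hk.2, fun x hx =>
    ⟨(hr x hx).1, (hr x hx).2.congr_deriv (by ring)⟩, hT.comp ?_⟩
  simpa using tendsto_neg_nhdsGT (a := -T)

lemma exists_isSolution_of_mem_leftBlowupPoints {a x₀ : ℝ} (ha : a ∈ leftBlowupPoints x₀) :
    ∃ u p : ℝ → ℝ, IsSolution 1 u p (Ico (-x₀) (-a)) := by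
  obtain ⟨y, y', -, hy, -⟩ := ha
  have h : IsSolution (-1) y y' (Ioc a x₀) := fun x hx =>
    ⟨(hy x hx).1, (hy x hx).2.congr_deriv (by ring)⟩
  have hr := h.reflect (I := Ico (-x₀) (-a))
    fun s hs => ⟨by linarith [hs.2], by linarith [hs.1]⟩
  rw [neg_neg] at hr
  exact ⟨_, _, hr⟩

lemma bddBelow_leftBlowupPoints {x₀ : ℝ} (hx₀ : x₀ ≤ 0) : BddBelow (leftBlowupPoints x₀) := by
  refine ⟨x₀ - 1 - 2 * painleveC, fun a ha => ?_⟩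
  obtain ⟨u, p, h⟩ := exists_isSolution_of_mem_leftBlowupPoints ha
  have : -a ≤ -x₀ + 1 + 2 * painleveC := le_of_forall_lt_imp_le_of_dense fun R hR =>
    (h.mono (Icc_subset_Ico_right hR)).length_le (neg_nonneg.2 hx₀)
  linarith

lemma leftBlowupPoints_nonempty {x₀ : ℝ} (hx₀ : x₀ ≤ 0) : (leftBlowupPoints x₀).Nonempty := by
  obtain ⟨δ, hδ, u, p, -, -, h⟩ := exists_local_solution 1 (-x₀) 0 0
  obtain ⟨T, hT, u', p', -, -, h', hlim⟩ := h.exists_blowup (neg_nonneg.2 hx₀)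
    ⟨by linarith, by linarith⟩
  have := neg_mem_leftBlowupPoints (k := -x₀) ⟨by linarith, by linarith⟩ h' hlim
  rw [neg_neg] at this
  exact ⟨-T, this⟩

/-- A solution of `u'' = 6u² + s` at rest at `c` takes at least as long to blow up as the
solution of `u'' = 6u² + l⁴` started at rest from the same value, while `s ≤ l⁴`. -/
lemma IsSolution.blowupTime_le_sub {u p : ℝ → ℝ} {c T l : ℝ} (hc : 0 < c) (hcT : c < T)
    (hl : 0 < l) (hTl : T ≤ l ^ 4) (h : IsSolution 1 u p (Ico c T)) (hpc : p c = 0)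
    (hT : Tendsto u (𝓝[<] T) atTop) : blowupTime (u c / l ^ 2) / l ≤ T - c := by
  have hlim : Tendsto (fun t => passageTime (u c) (l ^ 4) √(u t - u c)) (𝓝[<] T)
      (𝓝 (blowupTime (u c / l ^ 2) / l)) :=
    (tendsto_passageTime (u c) hl).comp
      (Real.tendsto_sqrt_atTop.comp (tendsto_atTop_add_const_right _ (-u c) hT))
  refine le_of_tendsto hlim ?_
  filter_upwards [Ioo_mem_nhdsLT hcT] with t ht
  have h' := h.mono (Icc_subset_Ico_right ht.2)
  have := passageTime_le_sub (K := l ^ 4) ht.1.le (fun s hs => (h' s hs).1)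
    (fun s hs => (h' s hs).2) hpc (fun s hs => by linarith [hs.1])
    fun s hs => by linarith [hs.2, ht.2]
  linarith [ht.2]

/-- A solution of `u'' = 6u² - s` started at rest exists for at least a time `d` if `d` is less
than the blow-up time of the solution of `u'' = 6u² + l⁴` with the same data. -/
lemma exists_isSolution_of_lt_blowupTime {m l k d : ℝ} (hl : 0 < l) (hk : 0 < k)
    (hK : k + d ≤ l ^ 4) (hlt : d < blowupTime (m / l ^ 2) / l) :
    ∃ a < k, ∃ b > k + d, ∃ u p : ℝ → ℝ, u (k + d) = m ∧ p (k + d) = 0 ∧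
      IsSolution 1 u p (Ioo a b) := by
  set c := -(k + d) with hc
  obtain ⟨δ, hδ, u₀, p₀, hu₀, hp₀, h₀⟩ := exists_local_solution (-1) c m 0
  obtain ⟨R, hR, u, p, hu, hp, h⟩ : ∃ R > -k, ∃ u p : ℝ → ℝ, u c = m ∧ p c = 0 ∧
      IsSolution (-1) u p (Ioo (c - δ) R) := by
    rcases h₀.exists_maximal (c := c) ⟨by linarith, by linarith⟩ with
      hall | ⟨T, hT, u, p, hu, hp, h, hM⟩
    · obtain ⟨u, p, hu, hp, h⟩ := hall (-k + 1)
      exact ⟨-k + 1, by linarith, u, p, hu.trans hu₀, hp.trans hp₀, h⟩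
    rw [hu₀] at hu
    rw [hp₀] at hp
    refine ⟨T, ?_, u, p, hu, hp, h⟩
    by_contra! hTk
    obtain ⟨W, hW0, hW⟩ : ∃ W, 0 < W ∧ d < passageTime m (l ^ 4) W :=
      ((eventually_gt_atTop 0).and ((tendsto_passageTime m hl).eventually_const_lt hlt)).exists
    set N := 4 * ((m + W ^ 2) ^ 3 - m ^ 3) + 2 * l ^ 4 * W ^ 2 with hN
    have hbound : ∀ t ∈ Ico c T, |u t| ≤ |m| + W ^ 2 ∧ |p t| ≤ √N := by
      intro t ht
      have h' := h.mono (Icc_subset_Ioo (a₁ := c) (by linarith) ht.2)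
      have hf0 : ∀ s ∈ Icc c t, 0 < -1 * s := fun s hs => by linarith [hs.2, ht.2]
      have hfK : ∀ s ∈ Icc c t, -1 * s ≤ l ^ 4 := fun s hs => by linarith [hs.1]
      have htime := passageTime_le_sub ht.1 (fun s hs => (h' s hs).1) (fun s hs => (h' s hs).2)
        hp hf0 hfK
      have hmu : m ≤ u t := by
        rcases ht.1.eq_or_lt with rfl | hct
        · exact hu.ge
        · exact hu ▸ (deriv_pos_and_lt_of_forcing_pos (fun s hs => (h' s hs).1)
            (fun s hs => (h' s hs).2) hf0 hp.ge ⟨hct, le_rfl⟩).2.le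
      have henergy := energy_le_energy_of_forcing_le (fun s hs => (h' s hs).1)
        (fun s hs => (h' s hs).2) hf0 hp.ge hfK m (right_mem_Icc.2 ht.1)
      rw [hu] at htime henergy
      have hsqrt : √(u t - m) < W := by
        refine (strictMono_passageTime m (by positivity : 0 < l ^ 4)).lt_iff_lt.1 ?_
        linarith [ht.2]
      have huW : u t ≤ m + W ^ 2 := by
        have := (Real.sqrt_lt' hW0).1 hsqrt
        linarith
      refine ⟨abs_le.2 ⟨?_, ?_⟩, Real.abs_le_sqrt ?_⟩
      · linarith [neg_abs_le m, sq_nonneg W]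
      · linarith [le_abs_self m]
      · have h3 : u t ^ 3 ≤ (m + W ^ 2) ^ 3 := Odd.strictMono_pow (by decide) |>.monotone huW
        have h1 : 2 * l ^ 4 * (u t - m) ≤ 2 * l ^ 4 * W ^ 2 := by
          gcongr
          linarith
        simp only [energy, hp, sub_self] at henergy
        rw [hN]
        linarith
    obtain ⟨t, ht, hbig⟩ := hM (max (|m| + W ^ 2) √N)
    rcases hbig with hbig | hbig
    · exact absurd (hbound t ht).1 (not_le.2 ((le_max_left _ _).trans_lt hbig))
    · exact absurd (hbound t ht).2 (not_le.2 ((le_max_right _ _).trans_lt hbig))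
  have hr := h.reflect (I := Ioo (-R) (k + d + δ))
    fun s hs => ⟨by linarith [hs.2], by linarith [hs.1]⟩
  rw [neg_neg] at hr
  exact ⟨-R, by linarith, k + d + δ, by linarith, _, _, by rw [← hc, hu],
    by rw [← hc, hp, neg_zero], hr⟩

lemma exists_mem_leftBlowupPoints_lt {k D : ℝ} (hk : 0 < k) (hD : 0 < D)
    (hlt : D < 2 * painleveC / (k + 2 * painleveC / k ^ ((1:ℝ) / 4)) ^ ((1:ℝ) / 4)) :
    ∃ a ∈ leftBlowupPoints (-k), a < -k - D := by
  have hC := painleveC_pos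
  set K := k + 2 * painleveC / k ^ ((1:ℝ) / 4) with hK
  have hkK : k ≤ K := by
    rw [hK]
    exact le_add_of_nonneg_right (by positivity)
  have hK0 : 0 < K := hk.trans_le hkK
  set l := K ^ ((1:ℝ) / 4) with hl
  have hl0 : 0 < l := Real.rpow_pos_of_pos hK0 _
  have hl4 : l ^ 4 = K := rpow_quarter_pow hK0
  obtain ⟨v, hv⟩ : ∃ v, D / 2 * l < blowupTime v := exists_lt_blowupTime (by
    rw [lt_div_iff₀ hl0] at hlt
    linarith)
  have hDK : k + D / 2 ≤ K := by
    have : 2 * painleveC / l ≤ 2 * painleveC / k ^ ((1:ℝ) / 4) := by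
      rw [hl]
      gcongr
    linarith
  have hv' : v * l ^ 2 / l ^ 2 = v := by field_simp
  have hvl : D / 2 < blowupTime (v * l ^ 2 / l ^ 2) / l := by rwa [hv', lt_div_iff₀ hl0]
  obtain ⟨a, ha, b, hb, u₀, p₀, hu₀, hp₀, h₀⟩ :=
    exists_isSolution_of_lt_blowupTime hl0 hk (hl4 ▸ hDK) hvl
  have hc0 : 0 < k + D / 2 := by linarith
  obtain ⟨T, hT, u, p, hu, hp, h, hlim⟩ := h₀.exists_blowup hc0.le ⟨by linarith, hb⟩
  have hcT : k + D / 2 < T := hb.trans_le hT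
  obtain ⟨B, hB, hlen⟩ := exists_uniform_length_bound hk
  have hTB : T ≤ k + B := le_of_forall_lt_imp_le_of_dense fun R hR => by
    rcases le_or_gt k R with hkR | hkR
    · linarith [hlen u p R hkR (h.mono (Icc_subset_Ioo ha hR))]
    · linarith [hlen u p k le_rfl (h.mono (Icc_subset_Ioo ha (by linarith)))]
  have hasc := (h.mono (Ico_subset_Ioo_left (by linarith))).blowupTime_le_sub hc0 hcT hl0
    (by linarith) (hp.trans hp₀) hlim
  rw [hu, hu₀] at hasc
  exact ⟨-T, neg_mem_leftBlowupPoints ⟨ha, by linarith⟩ h hlim, by linarith⟩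

lemma sub_lt_div_rpow_add {c k : ℝ} (hc : 0 < c) (hk : (2 * c) ^ ((4:ℝ) / 5) < k) :
    0 < 2 * c / k ^ ((1:ℝ) / 4) - c ^ 2 / k ^ ((3:ℝ) / 2) ∧
    2 * c / k ^ ((1:ℝ) / 4) - c ^ 2 / k ^ ((3:ℝ) / 2) <
      2 * c / (k + 2 * c / k ^ ((1:ℝ) / 4)) ^ ((1:ℝ) / 4) := by
  have hk0 : 0 < k := (by positivity : 0 < (2 * c) ^ ((4:ℝ) / 5)).trans hk
  set q := k ^ ((1:ℝ) / 4) with hq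
  have hq0 : 0 < q := Real.rpow_pos_of_pos hk0 _
  have hq4 : q ^ 4 = k := rpow_quarter_pow hk0
  have hq6 : k ^ ((3:ℝ) / 2) = q ^ 6 := by
    rw [hq, ← Real.rpow_natCast, ← Real.rpow_mul hk0.le]
    norm_num
  have hq5 : 2 * c < q ^ 5 := by
    have h1 := Real.rpow_lt_rpow (by positivity) hk (by norm_num : (0:ℝ) < 5 / 4)
    rw [← Real.rpow_mul (by positivity)] at h1
    rw [hq, ← Real.rpow_natCast, ← Real.rpow_mul hk0.le]
    norm_num at h1 ⊢
    exact h1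
  obtain ⟨z, hz⟩ : ∃ z, 2 * c = z * q ^ 5 := ⟨2 * c / q ^ 5, by field_simp⟩
  have hz0 : 0 < z := by
    have h1 : 0 < z * q ^ 5 := by rw [← hz]; positivity
    exact pos_of_mul_pos_left h1 (by positivity)
  have hz1 : z < 1 := by
    rw [hz] at hq5
    nlinarith [pow_pos hq0 5]
  have hc' : c = z * q ^ 5 / 2 := by linarith
  have hD : 2 * c / q - c ^ 2 / q ^ 6 = z * q ^ 4 * (1 - z / 4) := by
    rw [hc']
    field_simp
    ring
  have hK : k + 2 * c / q = q ^ 4 * (1 + z) := by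
    rw [hz, hq4.symm]
    field_simp
  rw [hq6, hD, hK]
  refine ⟨mul_pos (by positivity) (by linarith), ?_⟩
  set l := (q ^ 4 * (1 + z)) ^ ((1:ℝ) / 4) with hl
  have hl0 : 0 < l := by positivity
  have hl4 : l ^ 4 = q ^ 4 * (1 + z) := rpow_quarter_pow (by positivity)
  rw [lt_div_iff₀ hl0, hz]
  have key : (1 - z / 4) * l < q := by
    refine lt_of_pow_lt_pow_left₀ 4 hq0.le ?_
    rw [mul_pow, hl4]
    have h1 : (1 - z / 4) ^ 4 * (1 + z) < 1 := by
      have h2 : 1 + z < (1 + z / 4) ^ 4 := by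
        nlinarith [pow_pos hz0 2, pow_pos hz0 3, pow_pos hz0 4]
      have h3 : 0 < (1 - z / 4) ^ 4 := pow_pos (by linarith) 4
      calc (1 - z / 4) ^ 4 * (1 + z) < (1 - z / 4) ^ 4 * (1 + z / 4) ^ 4 := by gcongr
        _ = (1 - z ^ 2 / 16) ^ 4 := by ring
        _ ≤ 1 := pow_le_one₀ (by nlinarith) (by nlinarith)
    calc (1 - z / 4) ^ 4 * (q ^ 4 * (1 + z)) = q ^ 4 * ((1 - z / 4) ^ 4 * (1 + z)) := by ring
      _ < q ^ 4 := mul_lt_of_lt_one_right (by positivity) h1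
  calc z * q ^ 4 * (1 - z / 4) * l = z * q ^ 4 * ((1 - z / 4) * l) := by ring
    _ < z * q ^ 4 * q := by gcongr
    _ = z * q ^ 5 := by ring

/-- `X(x₀)`, the infimum of left blow-up points over all solutions of
`y'' = 6y² - x` regular at `x₀ ≤ 0`, is finite and satisfies the asymptotics
`X(x₀) = x₀ - 2C/|x₀|^{1/4} + O(|x₀|^{-3/2})` as `x₀ → -∞`, with the explicit
bounds `0 < X(x₀) - (x₀ - 2C/|x₀|^{1/4}) < C²/|x₀|^{3/2}` for `|x₀| > (2C)^{4/5}`. -/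
theorem painleveI_X_asymptotics (x₀ : ℝ) (hx₀ : x₀ ≤ 0)
    (A : Set ℝ)
    (hA : A = {a : ℝ | ∃ y y' : ℝ → ℝ, a < x₀ ∧
      (∀ x ∈ Set.Ioc a x₀,
        HasDerivAt y (y' x) x ∧ HasDerivAt y' (6 * (y x) ^ 2 - x) x) ∧
      Tendsto y (𝓝[>] a) atTop}) :
    A.Nonempty ∧ BddBelow A ∧
    ((2 * painleveC) ^ ((4:ℝ)/5) < |x₀| →
      0 < sInf A - (x₀ - 2 * painleveC / |x₀| ^ ((1:ℝ)/4)) ∧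
      sInf A - (x₀ - 2 * painleveC / |x₀| ^ ((1:ℝ)/4)) <
        painleveC ^ 2 / |x₀| ^ ((3:ℝ)/2)) := by
  subst hA
  change (leftBlowupPoints x₀).Nonempty ∧ BddBelow (leftBlowupPoints x₀) ∧ (_ →
    0 < sInf (leftBlowupPoints x₀) - _ ∧ sInf (leftBlowupPoints x₀) - _ < _)
  have hne := leftBlowupPoints_nonempty hx₀
  have hbdd := bddBelow_leftBlowupPoints hx₀
  refine ⟨hne, hbdd, fun hlarge => ?_⟩
  have hC := painleveC_pos
  obtain ⟨k, rfl⟩ : ∃ k, x₀ = -k := ⟨-x₀, (neg_neg _).symm⟩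
  rw [abs_neg, abs_of_nonneg (neg_nonpos.1 hx₀)] at hlarge ⊢
  have hk : 0 < k := (by positivity : 0 < (2 * painleveC) ^ ((4:ℝ) / 5)).trans hlarge
  constructor
  · obtain ⟨B, hB, hlen⟩ := exists_uniform_length_bound hk
    have : -k - B ≤ sInf (leftBlowupPoints (-k)) := le_csInf hne fun a ha => by
      have hak : a < -k := ha.choose_spec.choose_spec.1
      obtain ⟨u, p, h⟩ := exists_isSolution_of_mem_leftBlowupPoints ha
      rw [neg_neg] at h
      have : -a ≤ k + B := le_of_forall_lt_imp_le_of_dense fun R hR => by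
        have hmax : max R k < -a := max_lt hR (by linarith)
        linarith [hlen u p _ (le_max_right R k) (h.mono (Icc_subset_Ico_right hmax)),
          le_max_left R k]
      linarith
    linarith
  · obtain ⟨hD, hlt⟩ := sub_lt_div_rpow_add hC hlarge
    obtain ⟨a, ha, hak⟩ := exists_mem_leftBlowupPoints_lt hk hD hlt
    have := csInf_le hbdd ha
    linarith
end

section
/- Any two distinct real solutions of y'' = 6y² − x have at most two points of intersection with non-positive abscissas, where intersections at infinity (a common pole, i.e., a common endpoint of the intervals of existence) are counted as intersection points. -/
open Filter Set Topology

/-- A function vanishing with negative slope at `q`, and decreasing as long as it stays positive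
to the left of `q`, is positive and decreasing on the whole interval to the left of `q`. -/
lemma pos_and_deriv_neg_left {p q : ℝ} {w w' : ℝ → ℝ}
    (hw : ∀ x ∈ Ioc p q, HasDerivAt w (w' x) x) (hq : w q = 0) (hq' : w' q < 0)
    (H : ∀ s, p ≤ s → s < q → (∀ x ∈ Ioo s q, 0 < w x) → ∀ x ∈ Ioo s q, w' x < 0) :
    ∀ x ∈ Ioo p q, 0 < w x ∧ w' x < 0 := by
  rcases le_or_gt q p with hpq | hpq
  · intro x hx
    exact absurd (hx.1.trans hx.2) (not_lt.2 hpq)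
  have hpos : ∀ x ∈ Ioo p q, 0 < w x := by
    by_contra! hcon
    obtain ⟨x, hx, hwx⟩ := hcon
    have hnear : ∀ᶠ t in 𝓝[<] q, 0 < w t := by
      have h1 := (hasDerivAt_iff_tendsto_slope.1 (hw q ⟨hpq, le_rfl⟩)).eventually
        (gt_mem_nhds hq')
      have h2 : ∀ᶠ t in 𝓝[<] q, slope w q t < 0 :=
        h1.filter_mono (nhdsWithin_mono _ fun t ht => ne_of_lt ht)
      filter_upwards [h2, self_mem_nhdsWithin] with t ht htq
      rw [slope_def_field, hq, sub_zero, div_neg_iff] at ht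
      have : t < q := htq
      rcases ht with h | h
      · exact h.1
      · linarith [h.2]
    obtain ⟨l, hl, hlq⟩ := (mem_nhdsLT_iff_exists_Ioo_subset).1 hnear
    have hlq' : l < q := hl
    set m := (max l x + q) / 2 with hm
    have hmax : max l x < q := max_lt hlq' hx.2
    have hxm : x < m := by have := le_max_right l x; linarith
    have hlm : l < m := by have := le_max_left l x; linarith
    have hmq : m < q := by linarith
    have hcont : ContinuousOn w (Icc x m) := fun t ht =>
      (hw t ⟨hx.1.trans_le ht.1, ht.2.trans hmq.le⟩).continuousAt.continuousWithinAt
    have hcomp : IsCompact (Icc x m ∩ w ⁻¹' Iic 0) :=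
      isCompact_Icc.of_isClosed_subset
        (hcont.preimage_isClosed_of_isClosed isClosed_Icc isClosed_Iic) inter_subset_left
    obtain ⟨s, ⟨hs, hws⟩, hsmax⟩ := hcomp.exists_isGreatest ⟨x, ⟨le_rfl, hxm.le⟩, hwx⟩
    have hps : p < s := hx.1.trans_le hs.1
    have hsq : s < q := hs.2.trans_lt hmq
    have hsw : ∀ t ∈ Ioo s q, 0 < w t := by
      intro t ht
      by_contra! hneg
      rcases le_or_gt t m with htm | htm
      · exact absurd (hsmax ⟨⟨hs.1.trans ht.1.le, htm⟩, hneg⟩) (not_le.2 ht.1)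
      · exact absurd (hlq ⟨hlm.trans htm, ht.2⟩ : 0 < w t) (not_lt.2 hneg)
    have hd := H s hps.le hsq hsw
    have hanti : StrictAntiOn w (Icc s q) := by
      apply strictAntiOn_of_hasDerivWithinAt_neg (convex_Icc s q)
        (fun t ht => (hw t ⟨hps.trans_le ht.1, ht.2⟩).continuousAt.continuousWithinAt)
        (f' := w')
      · intro t ht
        rw [interior_Icc] at ht
        exact (hw t ⟨hps.trans ht.1, ht.2.le⟩).hasDerivWithinAt
      · intro t ht
        rw [interior_Icc] at ht
        exact hd t ht
    have := hanti ⟨le_rfl, hsq.le⟩ ⟨hsq.le, le_rfl⟩ hsq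
    have h0 : w s ≤ 0 := hws
    linarith
  exact fun x hx => ⟨hpos x hx, H p le_rfl hpq hpos x hx⟩

/-- Reflected form of `pos_and_deriv_neg_left`. -/
lemma neg_and_deriv_neg_right {q r : ℝ} {w w' : ℝ → ℝ}
    (hw : ∀ x ∈ Ico q r, HasDerivAt w (w' x) x) (hq : w q = 0) (hq' : w' q < 0)
    (H : ∀ s, s ≤ r → q < s → (∀ x ∈ Ioo q s, w x < 0) → ∀ x ∈ Ioo q s, w' x < 0) :
    ∀ x ∈ Ioo q r, w x < 0 ∧ w' x < 0 := by
  have key := pos_and_deriv_neg_left (p := -r) (q := -q) (w := fun t => -w (-t))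
    (w' := fun t => w' (-t)) ?_ (by simp [hq]) (by simpa using hq') ?_
  · intro x hx
    have := key (-x) ⟨by linarith [hx.2], by linarith [hx.1]⟩
    simpa using this
  · intro t ht
    have h1 := (hw (-t) ⟨by linarith [ht.2], by linarith [ht.1]⟩).comp t (hasDerivAt_neg t)
    simpa [Function.comp_def] using h1.fun_neg
  · intro s hs hsq hpos t ht
    refine H (-s) (by linarith) (by linarith) ?_ (-t) ⟨by linarith [ht.2], by linarith [ht.1]⟩
    intro x hx
    have := hpos (-x) ⟨by linarith [hx.2], by linarith [hx.1]⟩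
    simpa using this

/-- A function starting above `m` with positive slope, and convex while it is above `m`, stays
above `m`. -/
lemma lt_of_convex_while_above {c e m : ℝ} {z z' z'' : ℝ → ℝ}
    (hz : ∀ x ∈ Ico c e, HasDerivAt z (z' x) x) (hz' : ∀ x ∈ Ico c e, HasDerivAt z' (z'' x) x)
    (hc : m < z c) (hc' : 0 < z' c) (H : ∀ x ∈ Ico c e, m ≤ z x → 0 ≤ z'' x) :
    ∀ x ∈ Ico c e, m < z x := by
  by_contra! hcon
  obtain ⟨x, hx, hzx⟩ := hcon
  have hcont : ContinuousOn z (Icc c x) := fun t ht =>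
    (hz t ⟨ht.1, ht.2.trans_lt hx.2⟩).continuousAt.continuousWithinAt
  have hcomp : IsCompact (Icc c x ∩ z ⁻¹' Iic m) :=
    isCompact_Icc.of_isClosed_subset
      (hcont.preimage_isClosed_of_isClosed isClosed_Icc isClosed_Iic) inter_subset_left
  obtain ⟨s, ⟨hs, hzs⟩, hsmin⟩ := hcomp.exists_isLeast ⟨x, ⟨hx.1, le_rfl⟩, hzx⟩
  have hse : s < e := hs.2.trans_lt hx.2
  have habove : ∀ t ∈ Ico c s, m < z t := by
    intro t ht
    by_contra! hneg
    exact absurd (hsmin ⟨⟨ht.1, ht.2.le.trans hs.2⟩, hneg⟩) (not_le.2 ht.2)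
  have hmono' : MonotoneOn z' (Icc c s) := by
    apply monotoneOn_of_hasDerivWithinAt_nonneg (convex_Icc c s)
      (fun t ht => (hz' t ⟨ht.1, ht.2.trans_lt hse⟩).continuousAt.continuousWithinAt)
      (f' := z'')
    · intro t ht
      rw [interior_Icc] at ht
      exact (hz' t ⟨ht.1.le, ht.2.trans hse⟩).hasDerivWithinAt
    · intro t ht
      rw [interior_Icc] at ht
      exact H t ⟨ht.1.le, ht.2.trans hse⟩ (habove t ⟨ht.1.le, ht.2⟩).le
  have hmono : MonotoneOn z (Icc c s) := by
    apply monotoneOn_of_hasDerivWithinAt_nonneg (convex_Icc c s)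
      (fun t ht => (hz t ⟨ht.1, ht.2.trans_lt hse⟩).continuousAt.continuousWithinAt)
      (f' := z')
    · intro t ht
      rw [interior_Icc] at ht
      exact (hz t ⟨ht.1.le, ht.2.trans hse⟩).hasDerivWithinAt
    · intro t ht
      rw [interior_Icc] at ht
      exact hc'.le.trans (hmono' ⟨le_rfl, hs.1⟩ ⟨ht.1.le, ht.2.le⟩ ht.1.le)
  have h1 := hmono ⟨le_rfl, hs.1⟩ ⟨hs.1, le_rfl⟩ hs.1
  have h2 : z s ≤ m := hzs
  linarith

/-- Two solutions of `u'' = 6u² - κx` whose difference is positive and increasing cannot blow up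
at the same point: a small shift of the larger one still dominates the smaller one. -/
lemma no_common_pole_right {q r κ : ℝ} (hqr : q < r) {u u' v v' : ℝ → ℝ}
    (hu : ∀ x ∈ Ioo q r, HasDerivAt u (u' x) x ∧ HasDerivAt u' (6 * u x ^ 2 - κ * x) x)
    (hv : ∀ x ∈ Ioo q r, HasDerivAt v (v' x) x ∧ HasDerivAt v' (6 * v x ^ 2 - κ * x) x)
    (hur : Tendsto u (𝓝[<] r) atTop) (hvr : Tendsto v (𝓝[<] r) atTop)
    (huv : ∀ x ∈ Ioo q r, u x < v x ∧ u' x < v' x)  : False := by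
  have hev : ∀ᶠ x in 𝓝[<] r, 1 ≤ u x ∧ 1 ≤ v x :=
    (hur.eventually_ge_atTop 1).and (hvr.eventually_ge_atTop 1)
  obtain ⟨l, hl, hlr⟩ := (mem_nhdsLT_iff_exists_Ioo_subset).1 hev
  have hlr' : l < r := hl
  obtain ⟨c, hc1, hcr⟩ := exists_between (max_lt hlr' hqr)
  have hlc : l < c := (le_max_left l q).trans_lt hc1
  have hqc : q < c := (le_max_right l q).trans_lt hc1
  have hone : ∀ x, c ≤ x → x < r → 1 ≤ u x ∧ 1 ≤ v x := fun x h1 h2 =>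
    hlr ⟨hlc.trans_le h1, h2⟩
  obtain ⟨m, hum, hmv⟩ : ∃ m, 0 < m ∧ u c < v c - m :=
    ⟨(v c - u c) / 2, by linarith [(huv c ⟨hqc, hcr⟩).1], by linarith [(huv c ⟨hqc, hcr⟩).1]⟩
  have hshift : Tendsto (fun g : ℝ => c + g) (𝓝 0) (𝓝 c) := by
    have : ContinuousAt (fun g : ℝ => c + g) 0 := by fun_prop
    simpa [ContinuousAt] using this
  have e1 : ∀ᶠ g in 𝓝 (0 : ℝ), u (c + g) < v c - m :=
    hshift.eventually ((hu c ⟨hqc, hcr⟩).1.continuousAt.eventually_lt_const hmv)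
  have e2 : ∀ᶠ g in 𝓝 (0 : ℝ), u' (c + g) < v' c :=
    hshift.eventually
      ((hu c ⟨hqc, hcr⟩).2.continuousAt.eventually_lt_const (huv c ⟨hqc, hcr⟩).2)
  have e3 : ∀ᶠ g in 𝓝 (0 : ℝ), c + g < r := hshift.eventually (gt_mem_nhds hcr)
  have e4 : ∀ᶠ g in 𝓝 (0 : ℝ), -(12 * m) < κ * g := by
    have : ContinuousAt (fun g : ℝ => κ * g) 0 := by fun_prop
    apply this.eventually_const_lt
    simpa using hum
  obtain ⟨g, ⟨hg1, hg2, hg3, hg4⟩, hg0⟩ :=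
    (((e1.and (e2.and (e3.and e4))).filter_mono nhdsWithin_le_nhds).and
      (self_mem_nhdsWithin : Ioi (0 : ℝ) ∈ 𝓝[>] (0 : ℝ))).exists
  have hg0 : 0 < g := hg0
  have hcmp : ∀ x ∈ Ico c (r - g), m < v x - u (x + g) := by
    apply lt_of_convex_while_above (z' := fun x => v' x - u' (x + g))
      (z'' := fun x => (6 * v x ^ 2 - κ * x) - (6 * u (x + g) ^ 2 - κ * (x + g)))
    · intro x hx
      exact (hv x ⟨hqc.trans_le hx.1, by linarith [hx.2]⟩).1.sub
        ((hu (x + g) ⟨by linarith [hx.1], by linarith [hx.2]⟩).1.comp_add_const x g)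
    · intro x hx
      exact (hv x ⟨hqc.trans_le hx.1, by linarith [hx.2]⟩).2.sub
        ((hu (x + g) ⟨by linarith [hx.1], by linarith [hx.2]⟩).2.comp_add_const x g)
    · linarith
    · linarith
    · intro x hx hm
      have h1 := (hone x hx.1 (by linarith [hx.2])).2
      have h2 := (hone (x + g) (by linarith [hx.1]) (by linarith [hx.2])).1
      nlinarith
  have hrg : r - g ∈ Ioo q r := ⟨by linarith, by linarith⟩
  have hsub : Tendsto (fun x => x - g) (𝓝[<] r) (𝓝[<] (r - g)) := by
    apply tendsto_nhdsWithin_iff.2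
    refine ⟨?_, ?_⟩
    · exact (Continuous.tendsto (by fun_prop : Continuous fun x : ℝ => x - g) r).mono_left
        nhdsWithin_le_nhds
    · filter_upwards [self_mem_nhdsWithin] with x hx
      have : x < r := hx
      simpa using this
  have hvlim : Tendsto (fun x => v (x - g)) (𝓝[<] r) (𝓝 (v (r - g))) :=
    ((hv _ hrg).1.continuousAt.tendsto.mono_left nhdsWithin_le_nhds).comp hsub
  refine not_tendsto_nhds_of_tendsto_atTop (tendsto_atTop_mono' _ ?_ hur) _ hvlim
  filter_upwards [Ioo_mem_nhdsLT (by linarith : c + g < r)] with x hx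
  have := hcmp (x - g) ⟨by linarith [hx.1], by linarith [hx.2]⟩
  simp only [sub_add_cancel] at this
  linarith

/-- Reflected form of `no_common_pole_right`. -/
lemma no_common_pole_left {p q κ : ℝ} (hpq : p < q) {u u' v v' : ℝ → ℝ}
    (hu : ∀ x ∈ Ioo p q, HasDerivAt u (u' x) x ∧ HasDerivAt u' (6 * u x ^ 2 - κ * x) x)
    (hv : ∀ x ∈ Ioo p q, HasDerivAt v (v' x) x ∧ HasDerivAt v' (6 * v x ^ 2 - κ * x) x)
    (hup : Tendsto u (𝓝[>] p) atTop) (hvp : Tendsto v (𝓝[>] p) atTop)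
    (huv : ∀ x ∈ Ioo p q, u x < v x ∧ v' x < u' x) : False := by
  have hreflect : ∀ {y y' : ℝ → ℝ},
      (∀ x ∈ Ioo p q, HasDerivAt y (y' x) x ∧ HasDerivAt y' (6 * y x ^ 2 - κ * x) x) →
      ∀ t ∈ Ioo (-q) (-p), HasDerivAt (fun t => y (-t)) (-y' (-t)) t ∧
        HasDerivAt (fun t => -y' (-t)) (6 * y (-t) ^ 2 - (-κ) * t) t := by
    intro y y' hy t ht
    have h := hy (-t) ⟨by linarith [ht.2], by linarith [ht.1]⟩
    refine ⟨by simpa [Function.comp_def] using h.1.comp t (hasDerivAt_neg t), ?_⟩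
    simpa [Function.comp_def] using (h.2.comp t (hasDerivAt_neg t)).fun_neg
  have hlim : Tendsto (fun t : ℝ => -t) (𝓝[<] (-p)) (𝓝[>] p) := by
    simpa using tendsto_neg_nhdsLT (a := -p)
  refine no_common_pole_right (neg_lt_neg hpq) (hreflect hu) (hreflect hv)
    (hup.comp hlim) (hvp.comp hlim) fun t ht => ?_
  have h := huv (-t) ⟨by linarith [ht.2], by linarith [ht.1]⟩
  exact ⟨h.1, neg_lt_neg h.2⟩

/-- Sum `σ` and difference `w` of two solutions: if both `w` and `σ` have negative slope at a zero
`q ≤ 0` of `w`, then `w` is decreasing as long as it stays positive to the left of `q`. The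
comparison is with the solution `ρ` of the autonomous equation `ρ'' = 3ρ² - 2q`, parametrized by
its own value. -/
lemma deriv_neg_left_of_sum_deriv_neg {p q : ℝ} (hq0 : q ≤ 0) {σ σ' w w' : ℝ → ℝ}
    (hσ : ∀ x ∈ Ioc p q, HasDerivAt σ (σ' x) x)
    (hσ' : ∀ x ∈ Ioc p q, HasDerivAt σ' (3 * σ x ^ 2 + 3 * w x ^ 2 - 2 * x) x)
    (hw : ∀ x ∈ Ioc p q, HasDerivAt w (w' x) x)
    (hw' : ∀ x ∈ Ioc p q, HasDerivAt w' (6 * σ x * w x) x)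
    (hwq : w q = 0) (hwq' : w' q < 0) (hσq' : σ' q < 0) (hpos : ∀ x ∈ Ioo p q, 0 < w x) :
    ∀ x ∈ Ioo p q, w' x < 0 := by
  intro x₀ hx₀
  have hpx : ∀ {x}, x ∈ Icc x₀ q → x ∈ Ioc p q := fun hx => ⟨hx₀.1.trans_le hx.1, hx.2⟩
  have hσneg : ∀ x ∈ Icc x₀ q, σ' x < 0 := by
    have hmono : MonotoneOn σ' (Icc x₀ q) := by
      apply monotoneOn_of_hasDerivWithinAt_nonneg (convex_Icc _ _)
        (fun t ht => (hσ' t (hpx ht)).continuousAt.continuousWithinAt)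
        (fun t ht => (hσ' t (hpx (interior_subset ht))).hasDerivWithinAt)
      intro t ht
      have := (interior_subset ht).2
      nlinarith [sq_nonneg (σ t), sq_nonneg (w t)]
    intro x hx
    exact (hmono hx ⟨hx₀.2.le, le_rfl⟩ hx.2).trans_lt hσq'
  have hσanti : AntitoneOn σ (Icc x₀ q) := by
    apply antitoneOn_of_hasDerivWithinAt_nonpos (convex_Icc _ _)
      (fun t ht => (hσ t (hpx ht)).continuousAt.continuousWithinAt)
      (fun t ht => (hσ t (hpx (interior_subset ht))).hasDerivWithinAt)
    exact fun t ht => (hσneg t (interior_subset ht)).le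
  have hqmem : q ∈ Icc x₀ q := ⟨hx₀.2.le, le_rfl⟩
  have hσge : ∀ x ∈ Icc x₀ q, σ q ≤ σ x := fun x hx => hσanti hx hqmem hx.2
  obtain ⟨P, hP⟩ : ∃ P : ℝ → ℝ, P = fun u =>
    2 * (u ^ 3 - σ q ^ 3) - 4 * q * (u - σ q) + σ' q ^ 2 := ⟨_, rfl⟩
  have hPd : ∀ u, HasDerivAt P (2 * (3 * u ^ 2 - 2 * q)) u := by
    intro u
    rw [hP]
    have h1 := (((hasDerivAt_pow 3 u).sub_const (σ q ^ 3)).const_mul 2).sub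
      (((hasDerivAt_id u).sub_const (σ q)).const_mul (4 * q))
    refine (h1.add_const (σ' q ^ 2)).congr_deriv ?_
    norm_num
    ring
  have hPq : P (σ q) = σ' q ^ 2 := by simp [hP]
  have hPcont : Continuous P := continuous_iff_continuousAt.2 fun u => (hPd u).continuousAt
  have hPmono : Monotone P := by
    apply monotone_of_hasDerivAt_nonneg hPd
    intro u
    show 0 ≤ 2 * (3 * u ^ 2 - 2 * q)
    nlinarith [sq_nonneg u]
  have hPpos : ∀ u, σ q ≤ u → 0 < P u := fun u hu =>
    (by rw [hPq]; exact sq_pos_of_neg hσq' : 0 < P (σ q)).trans_le (hPmono hu)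
  have henergy : ∀ x ∈ Icc x₀ q, P (σ x) ≤ σ' x ^ 2 := by
    have hanti : AntitoneOn (fun x => σ' x ^ 2 - P (σ x)) (Icc x₀ q) := by
      have hder : ∀ t ∈ Icc x₀ q, HasDerivAt (fun x => σ' x ^ 2 - P (σ x))
          (2 * σ' t * (3 * w t ^ 2 - 2 * t + 2 * q)) t := by
        intro t ht
        refine (((hσ' t (hpx ht)).pow 2).sub
          ((hPd (σ t)).comp t (hσ t (hpx ht)))).congr_deriv ?_
        norm_num
        ring
      apply antitoneOn_of_hasDerivWithinAt_nonpos (convex_Icc _ _)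
        (fun t ht => (hder t ht).continuousAt.continuousWithinAt)
        (fun t ht => (hder t (interior_subset ht)).hasDerivWithinAt)
      intro t ht
      have ht := interior_subset ht
      have h1 := hσneg t ht
      have h2 : 0 ≤ 3 * w t ^ 2 - 2 * t + 2 * q := by nlinarith [sq_nonneg (w t), ht.2]
      nlinarith
    intro x hx
    have := hanti hx hqmem hx.2
    simp only [hPq, sub_self] at this
    linarith
  -- the time `τ u` which the comparison solution needs to climb from `σ q` to `u`
  obtain ⟨k, hk⟩ : ∃ k : ℝ → ℝ, k = fun u => (√(P (max u (σ q))))⁻¹ := ⟨_, rfl⟩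
  have hkpos : ∀ u, 0 < k u := by
    intro u
    rw [hk]
    exact inv_pos.2 (Real.sqrt_pos.2 (hPpos _ (le_max_right _ _)))
  have hkcont : Continuous k := by
    rw [hk]
    refine Continuous.inv₀ (by fun_prop) fun u => ?_
    exact (Real.sqrt_pos.2 (hPpos _ (le_max_right _ _))).ne'
  have hkR : ∀ u, σ q ≤ u → k u = (√(P u))⁻¹ := by
    intro u hu
    simp [hk, max_eq_left hu]
  obtain ⟨τ, hτ⟩ : ∃ τ : ℝ → ℝ, τ = fun u => ∫ s in (σ q)..u, k s := ⟨_, rfl⟩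
  have hτd : ∀ u, HasDerivAt τ (k u) u := by
    intro u
    rw [hτ]
    exact hkcont.integral_hasStrictDerivAt (σ q) u |>.hasDerivAt
  have hτ0 : τ (σ q) = 0 := by simp [hτ]
  have hτmono : StrictMono τ := strictMono_of_hasDerivAt_pos hτd hkpos
  have hτcont : Continuous τ := continuous_iff_continuousAt.2 fun u => (hτd u).continuousAt
  have htime : ∀ x ∈ Icc x₀ q, q - x ≤ τ (σ x) := by
    have hder : ∀ t ∈ Icc x₀ q, HasDerivAt (fun x => τ (σ x) + x) (k (σ t) * σ' t + 1) t :=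
      fun t ht => ((hτd (σ t)).comp t (hσ t (hpx ht))).add (hasDerivAt_id t)
    have hanti : AntitoneOn (fun x => τ (σ x) + x) (Icc x₀ q) := by
      apply antitoneOn_of_hasDerivWithinAt_nonpos (convex_Icc _ _)
        (fun t ht => (hder t ht).continuousAt.continuousWithinAt)
        (fun t ht => (hder t (interior_subset ht)).hasDerivWithinAt)
      intro t ht
      have ht := interior_subset ht
      have hR := Real.sqrt_pos.2 (hPpos (σ t) (hσge t ht))
      have h1 : √(P (σ t)) ≤ -σ' t :=
        Real.sqrt_le_iff.2 ⟨by linarith [hσneg t ht], by simpa using henergy t ht⟩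
      have h2 : 1 ≤ (√(P (σ t)))⁻¹ * (-σ' t) := by
        rw [inv_mul_eq_div]
        exact (one_le_div hR).2 h1
      rw [hkR _ (hσge t ht)]
      linarith
    intro x hx
    have := hanti hx hqmem hx.2
    simp only [hτ0] at this
    linarith
  have hx₀mem : x₀ ∈ Icc x₀ q := ⟨le_rfl, hx₀.2.le⟩
  obtain ⟨u₀, hu₀, hτu₀⟩ : ∃ u₀ ∈ Icc (σ q) (σ x₀), τ u₀ = q - x₀ :=
    intermediate_value_Icc (hσge _ hx₀mem) hτcont.continuousOn
      ⟨by rw [hτ0]; linarith [hx₀.2], htime _ hx₀mem⟩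
  have hX : ∀ u ∈ Icc (σ q) u₀, q - τ u ∈ Icc x₀ q := by
    intro u hu
    have h1 := hτmono.monotone hu.1
    have h2 := hτmono.monotone hu.2
    exact ⟨by linarith, by linarith⟩
  have hle : ∀ u ∈ Icc (σ q) u₀, u ≤ σ (q - τ u) := by
    intro u hu
    apply hτmono.le_iff_le.1
    linarith [htime _ (hX u hu)]
  have hwnonneg : ∀ x ∈ Icc x₀ q, 0 ≤ w x := by
    intro x hx
    rcases hx.2.eq_or_lt with h | h
    · rw [h, hwq]
    · exact (hpos x ⟨hx₀.1.trans_le hx.1, h⟩).le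
  have hder : ∀ u ∈ Icc (σ q) u₀, HasDerivAt
      (fun u => w' (q - τ u) * √(P u) + w (q - τ u) * (3 * u ^ 2 - 2 * q))
      (6 * w (q - τ u) * (u - σ (q - τ u))) u := by
    intro u hu
    have hPu := hPpos u hu.1
    have hR := Real.sqrt_pos.2 hPu
    have hXd : HasDerivAt (fun u => q - τ u) (-k u) u := (hτd u).const_sub q
    have h1 := (hw' _ (hpx (hX u hu))).comp u hXd
    have h2 := (hw _ (hpx (hX u hu))).comp u hXd
    have h3 := (hPd u).sqrt hPu.ne'
    have h4 : HasDerivAt (fun u : ℝ => 3 * u ^ 2 - 2 * q) (6 * u) u := by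
      refine (((hasDerivAt_pow 2 u).const_mul 3).sub_const (2 * q)).congr_deriv ?_
      norm_num
      ring
    refine ((h1.mul h3).add (h2.mul h4)).congr_deriv ?_
    simp only [Function.comp_apply]
    rw [hkR u hu.1]
    field_simp
    ring
  have hΩ : AntitoneOn (fun u => w' (q - τ u) * √(P u) + w (q - τ u) * (3 * u ^ 2 - 2 * q))
      (Icc (σ q) u₀) := by
    apply antitoneOn_of_hasDerivWithinAt_nonpos (convex_Icc _ _)
      (fun t ht => (hder t ht).continuousAt.continuousWithinAt)
      (fun t ht => (hder t (interior_subset ht)).hasDerivWithinAt)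
    intro u hu
    have hu := interior_subset hu
    have h1 := hwnonneg _ (hX u hu)
    have h2 := hle u hu
    exact mul_nonpos_of_nonneg_of_nonpos (by linarith) (by linarith)
  have hfin := hΩ ⟨le_rfl, hu₀.1⟩ ⟨hu₀.1, le_rfl⟩ hu₀.1
  simp only [hτ0, hτu₀, sub_zero, sub_sub_cancel, hwq, zero_mul, add_zero] at hfin
  have h1 : w' q * √(P (σ q)) < 0 :=
    mul_neg_of_neg_of_pos hwq' (Real.sqrt_pos.2 (hPpos _ le_rfl))
  have h2 : 0 ≤ w x₀ * (3 * u₀ ^ 2 - 2 * q) :=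
    mul_nonneg (hwnonneg _ hx₀mem) (by nlinarith [sq_nonneg u₀])
  have h3 : w' x₀ * √(P u₀) < 0 := by linarith
  by_contra! hcon
  exact absurd h3 (not_lt.2 (mul_nonneg hcon (Real.sqrt_nonneg _)))

/-- Sum `σ` and difference `w` of two solutions: if at a zero `q` of `w` the sum has non-negative
slope and `w` has negative slope, then `w` is decreasing as long as it stays negative to the right
of `q` (energy comparison). -/
lemma deriv_neg_right_of_sum_deriv_nonneg {q r : ℝ} (hr0 : r ≤ 0) {σ σ' w w' : ℝ → ℝ}
    (hσ : ∀ x ∈ Ico q r, HasDerivAt σ (σ' x) x)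
    (hσ' : ∀ x ∈ Ico q r, HasDerivAt σ' (3 * σ x ^ 2 + 3 * w x ^ 2 - 2 * x) x)
    (hw : ∀ x ∈ Ico q r, HasDerivAt w (w' x) x)
    (hw' : ∀ x ∈ Ico q r, HasDerivAt w' (6 * σ x * w x) x)
    (hwq : w q = 0) (hwq' : w' q < 0) (hσq' : 0 ≤ σ' q) (hneg : ∀ x ∈ Ioo q r, w x < 0) :
    ∀ x ∈ Ioo q r, w' x < 0 := by
  intro x₀ hx₀
  have hxr : ∀ {x}, x ∈ Icc q x₀ → x ∈ Ico q r := fun hx => ⟨hx.1, hx.2.trans_lt hx₀.2⟩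
  have hqmem : q ∈ Icc q x₀ := ⟨le_rfl, hx₀.1.le⟩
  have hx₀mem : x₀ ∈ Icc q x₀ := ⟨hx₀.1.le, le_rfl⟩
  have hσmono : MonotoneOn σ' (Icc q x₀) := by
    apply monotoneOn_of_hasDerivWithinAt_nonneg (convex_Icc _ _)
      (fun t ht => (hσ' t (hxr ht)).continuousAt.continuousWithinAt)
      (fun t ht => (hσ' t (hxr (interior_subset ht))).hasDerivWithinAt)
    intro t ht
    have := (hxr (interior_subset ht)).2
    nlinarith [sq_nonneg (σ t), sq_nonneg (w t)]
  have hder : ∀ t ∈ Icc q x₀, HasDerivAt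
      (fun x => w x * (3 * σ x ^ 2 + w x ^ 2 - 2 * x) - w' x * σ' x) (-2 * w t) t := by
    intro t ht
    have h1 := ((((hσ t (hxr ht)).pow 2).const_mul 3).add ((hw t (hxr ht)).pow 2)).sub
      ((hasDerivAt_id t).const_mul 2)
    refine (((hw t (hxr ht)).mul h1).sub ((hw' t (hxr ht)).mul (hσ' t (hxr ht)))).congr_deriv ?_
    norm_num
    ring
  have hK : StrictMonoOn (fun x => w x * (3 * σ x ^ 2 + w x ^ 2 - 2 * x) - w' x * σ' x)
      (Icc q x₀) := by
    apply strictMonoOn_of_hasDerivWithinAt_pos (convex_Icc _ _)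
      (fun t ht => (hder t ht).continuousAt.continuousWithinAt)
      (fun t ht => (hder t (interior_subset ht)).hasDerivWithinAt)
    intro t ht
    rw [interior_Icc] at ht
    have := hneg t ⟨ht.1, ht.2.trans hx₀.2⟩
    linarith
  have h1 := hK hqmem hx₀mem hx₀.1
  simp only [hwq, zero_mul, zero_sub] at h1
  have h2 : 0 ≤ σ' x₀ := hσq'.trans (hσmono hqmem hx₀mem hx₀.1.le)
  have h3 : w x₀ * (3 * σ x₀ ^ 2 + w x₀ ^ 2 - 2 * x₀) ≤ 0 :=
    mul_nonpos_of_nonpos_of_nonneg (hneg x₀ hx₀).le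
      (by nlinarith [sq_nonneg (σ x₀), sq_nonneg (w x₀), hx₀.2])
  have h4 : w' q * σ' q ≤ 0 := mul_nonpos_of_nonpos_of_nonneg hwq'.le hσq'
  have h5 : w' x₀ * σ' x₀ < 0 := by linarith
  by_contra! hcon
  exact absurd h5 (not_lt.2 (mul_nonneg hcon h2))

/-- A solution of a linear equation `w'' = g w` with zero initial data vanishes to the right. -/
lemma eq_zero_right_of_linear_ode {q x : ℝ} (hqx : q ≤ x) {w w' g : ℝ → ℝ}
    (hw : ∀ t ∈ Icc q x, HasDerivAt w (w' t) t) (hw' : ∀ t ∈ Icc q x, HasDerivAt w' (g t * w t) t)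
    (hg : ContinuousOn g (Icc q x)) (h0 : w q = 0) (h0' : w' q = 0) : w x = 0 := by
  obtain ⟨M, hM⟩ := isCompact_Icc.exists_bound_of_continuousOn hg
  have hder : ∀ t ∈ Icc q x, HasDerivAt (fun t => Real.exp (-(1 + M) * t) * (w t ^ 2 + w' t ^ 2))
      (Real.exp (-(1 + M) * t) *
        (2 * (w t * w' t) * (1 + g t) - (1 + M) * (w t ^ 2 + w' t ^ 2))) t := by
    intro t ht
    have h1 : HasDerivAt (fun t : ℝ => -(1 + M) * t) (-(1 + M)) t := by
      simpa using (hasDerivAt_id t).const_mul (-(1 + M))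
    refine (h1.exp.mul (((hw t ht).pow 2).add ((hw' t ht).pow 2))).congr_deriv ?_
    simp only [Pi.add_apply, Pi.pow_apply]
    norm_num
    ring
  have hanti : AntitoneOn (fun t => Real.exp (-(1 + M) * t) * (w t ^ 2 + w' t ^ 2)) (Icc q x) := by
    apply antitoneOn_of_hasDerivWithinAt_nonpos (convex_Icc _ _)
      (fun t ht => (hder t ht).continuousAt.continuousWithinAt)
      (fun t ht => (hder t (interior_subset ht)).hasDerivWithinAt)
    intro t ht
    apply mul_nonpos_of_nonneg_of_nonpos (Real.exp_pos _).le
    have h1 := abs_le.1 (hM t (interior_subset ht))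
    nlinarith [mul_nonneg (by linarith : 0 ≤ M + g t) (sq_nonneg (w t - w' t)),
      mul_nonneg (by linarith : 0 ≤ M - g t) (sq_nonneg (w t + w' t)), sq_nonneg (w t - w' t)]
  have h := hanti ⟨le_rfl, hqx⟩ ⟨hqx, le_rfl⟩ hqx
  simp only [h0, h0'] at h
  have hexp := Real.exp_pos (-(1 + M) * x)
  have h2 : w x ^ 2 + w' x ^ 2 ≤ 0 := by
    by_contra! hcon
    have := mul_pos hexp hcon
    rw [zero_pow two_ne_zero, add_zero, mul_zero] at h
    linarith
  nlinarith [sq_nonneg (w x), sq_nonneg (w' x)]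

/-- The difference of two solutions solves `w'' = 6 (y₁ + y₂) w`. -/
lemma hasDerivAt_sub_of_painleveI {y₁ y₁' y₂ y₂' : ℝ → ℝ} {x : ℝ}
    (h₁ : HasDerivAt y₁' (6 * y₁ x ^ 2 - x) x) (h₂ : HasDerivAt y₂' (6 * y₂ x ^ 2 - x) x) :
    HasDerivAt (fun t => y₁' t - y₂' t) (6 * (y₁ x + y₂ x) * (y₁ x - y₂ x)) x :=
  (h₁.fun_sub h₂).congr_deriv (by ring)

/-- The sum of two solutions solves `σ'' = 3σ² + 3w² - 2x`, where `w` is their difference. -/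
lemma hasDerivAt_add_of_painleveI {y₁ y₁' y₂ y₂' : ℝ → ℝ} {x : ℝ}
    (h₁ : HasDerivAt y₁' (6 * y₁ x ^ 2 - x) x) (h₂ : HasDerivAt y₂' (6 * y₂ x ^ 2 - x) x) :
    HasDerivAt (fun t => y₁' t + y₂' t)
      (3 * (y₁ x + y₂ x) ^ 2 + 3 * (y₁ x - y₂ x) ^ 2 - 2 * x) x :=
  (h₁.fun_add h₂).congr_deriv (by ring)

/-- Solutions with the same initial data at a point of an open interval agree there. -/
lemma painleveI_eqOn_of_initial_data {a b q : ℝ} {y₁ y₁' y₂ y₂' : ℝ → ℝ}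
    (h₁ : ∀ x ∈ Ioo a b, HasDerivAt y₁ (y₁' x) x ∧ HasDerivAt y₁' (6 * (y₁ x) ^ 2 - x) x)
    (h₂ : ∀ x ∈ Ioo a b, HasDerivAt y₂ (y₂' x) x ∧ HasDerivAt y₂' (6 * (y₂ x) ^ 2 - x) x)
    (hq : q ∈ Ioo a b) (h0 : y₁ q = y₂ q) (h0' : y₁' q = y₂' q) :
    ∀ x ∈ Ioo a b, y₁ x = y₂ x := by
  have hw : ∀ t ∈ Ioo a b, HasDerivAt (fun t => y₁ t - y₂ t) (y₁' t - y₂' t) t :=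
    fun t ht => (h₁ t ht).1.fun_sub (h₂ t ht).1
  have hw' : ∀ t ∈ Ioo a b, HasDerivAt (fun t => y₁' t - y₂' t)
      (6 * (y₁ t + y₂ t) * (y₁ t - y₂ t)) t :=
    fun t ht => hasDerivAt_sub_of_painleveI (h₁ t ht).2 (h₂ t ht).2
  have hg : ∀ t ∈ Ioo a b, ContinuousAt (fun t => 6 * (y₁ t + y₂ t)) t := fun t ht =>
    continuousAt_const.mul ((h₁ t ht).1.continuousAt.add (h₂ t ht).1.continuousAt)
  intro x hx
  rcases le_total q x with hqx | hxq
  · have hsub : ∀ {t}, t ∈ Icc q x → t ∈ Ioo a b := fun ht =>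
      ⟨hq.1.trans_le ht.1, ht.2.trans_lt hx.2⟩
    have := eq_zero_right_of_linear_ode hqx (fun t ht => hw t (hsub ht))
      (fun t ht => hw' t (hsub ht)) (fun t ht => (hg t (hsub ht)).continuousWithinAt)
      (sub_eq_zero.2 h0) (sub_eq_zero.2 h0')
    exact sub_eq_zero.1 this
  · have hsub : ∀ {t}, t ∈ Icc (-q) (-x) → -t ∈ Ioo a b := fun ht =>
      ⟨by linarith [ht.2, hx.1], by linarith [ht.1, hq.2]⟩
    have := eq_zero_right_of_linear_ode (neg_le_neg hxq) (w := fun t => y₁ (-t) - y₂ (-t))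
      (w' := fun t => -(y₁' (-t) - y₂' (-t))) (g := fun t => 6 * (y₁ (-t) + y₂ (-t)))
      (fun t ht => by
        simpa [Function.comp_def] using (hw (-t) (hsub ht)).comp t (hasDerivAt_neg t))
      (fun t ht => by
        simpa [Function.comp_def] using
          ((hw' (-t) (hsub ht)).comp t (hasDerivAt_neg t)).fun_neg)
      (fun t ht => ((hg (-t) (hsub ht)).comp
        (continuous_neg.continuousAt (x := t))).continuousWithinAt)
      (by simp [h0]) (by simp [h0'])
    simp only [neg_neg] at this
    exact sub_eq_zero.1 this

/-- Two solutions crossing transversally at `q` cannot also meet, at a regular point or at a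
common pole, on both sides of `q`. -/
lemma painleveI_no_three_intersections {p q r : ℝ} (hpq : p < q) (hqr : q < r) (hr0 : r ≤ 0)
    {y₁ y₁' y₂ y₂' : ℝ → ℝ}
    (h₁ : ∀ x ∈ Ioo p r, HasDerivAt y₁ (y₁' x) x ∧ HasDerivAt y₁' (6 * (y₁ x) ^ 2 - x) x)
    (h₂ : ∀ x ∈ Ioo p r, HasDerivAt y₂ (y₂' x) x ∧ HasDerivAt y₂' (6 * (y₂ x) ^ 2 - x) x)
    (hp : Tendsto (fun x => y₁ x - y₂ x) (𝓝[>] p) (𝓝 0) ∨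
      Tendsto y₁ (𝓝[>] p) atTop ∧ Tendsto y₂ (𝓝[>] p) atTop)
    (hr : Tendsto (fun x => y₁ x - y₂ x) (𝓝[<] r) (𝓝 0) ∨
      Tendsto y₁ (𝓝[<] r) atTop ∧ Tendsto y₂ (𝓝[<] r) atTop)
    (hq : y₁ q = y₂ q) (hq' : y₁' q < y₂' q) : False := by
  have hσ : ∀ t ∈ Ioo p r, HasDerivAt (fun t => y₁ t + y₂ t) (y₁' t + y₂' t) t :=
    fun t ht => (h₁ t ht).1.fun_add (h₂ t ht).1
  have hσ' : ∀ t ∈ Ioo p r, HasDerivAt (fun t => y₁' t + y₂' t)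
      (3 * (y₁ t + y₂ t) ^ 2 + 3 * (y₁ t - y₂ t) ^ 2 - 2 * t) t :=
    fun t ht => hasDerivAt_add_of_painleveI (h₁ t ht).2 (h₂ t ht).2
  have hw : ∀ t ∈ Ioo p r, HasDerivAt (fun t => y₁ t - y₂ t) (y₁' t - y₂' t) t :=
    fun t ht => (h₁ t ht).1.fun_sub (h₂ t ht).1
  have hw' : ∀ t ∈ Ioo p r, HasDerivAt (fun t => y₁' t - y₂' t)
      (6 * (y₁ t + y₂ t) * (y₁ t - y₂ t)) t :=
    fun t ht => hasDerivAt_sub_of_painleveI (h₁ t ht).2 (h₂ t ht).2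
  have hwq : y₁ q - y₂ q = 0 := sub_eq_zero.2 hq
  have hwq' : y₁' q - y₂' q < 0 := sub_neg.2 hq'
  rcases lt_or_ge (y₁' q + y₂' q) 0 with hs | hs
  · have hleft : ∀ {s t}, p ≤ s → t ∈ Ioc s q → t ∈ Ioo p r := fun hs ht =>
      ⟨hs.trans_lt ht.1, ht.2.trans_lt hqr⟩
    have key := pos_and_deriv_neg_left (fun x hx => hw x (hleft le_rfl hx)) hwq hwq'
      fun s hps _ hpos => deriv_neg_left_of_sum_deriv_neg (hqr.le.trans hr0)
        (fun x hx => hσ x (hleft hps hx)) (fun x hx => hσ' x (hleft hps hx))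
        (fun x hx => hw x (hleft hps hx)) (fun x hx => hw' x (hleft hps hx)) hwq hwq' hs hpos
    rcases hp with hp | ⟨hp₁, hp₂⟩
    · obtain ⟨m, hpm, hmq⟩ := exists_between hpq
      have hanti : AntitoneOn (fun t => y₁ t - y₂ t) (Ioc p m) := by
        have hsub : ∀ {t}, t ∈ Ioc p m → t ∈ Ioo p q := fun ht => ⟨ht.1, ht.2.trans_lt hmq⟩
        apply antitoneOn_of_hasDerivWithinAt_nonpos (convex_Ioc _ _)
          (fun t ht => (hw t (hleft le_rfl
            (Ioo_subset_Ioc_self (hsub ht)))).continuousAt.continuousWithinAt)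
          (fun t ht => (hw t (hleft le_rfl (Ioo_subset_Ioc_self
            (hsub (interior_subset ht))))).hasDerivWithinAt)
        exact fun t ht => (key t (hsub (interior_subset ht))).2.le
      refine absurd (ge_of_tendsto hp ?_) (not_le.2 (key m ⟨hpm, hmq⟩).1)
      filter_upwards [Ioo_mem_nhdsGT hpm] with t ht
      exact hanti ⟨ht.1, ht.2.le⟩ ⟨hpm, le_rfl⟩ ht.2.le
    · have hsub : ∀ {t}, t ∈ Ioo p q → t ∈ Ioo p r := fun ht => ⟨ht.1, ht.2.trans hqr⟩
      exact no_common_pole_left (κ := 1) hpq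
        (fun x hx => by simpa using h₂ x (hsub hx)) (fun x hx => by simpa using h₁ x (hsub hx))
        hp₂ hp₁ fun x hx => ⟨sub_pos.1 (key x hx).1, sub_neg.1 (key x hx).2⟩
  · have hright : ∀ {s t}, s ≤ r → t ∈ Ico q s → t ∈ Ioo p r := fun hs ht =>
      ⟨hpq.trans_le ht.1, ht.2.trans_le hs⟩
    have key := neg_and_deriv_neg_right (fun x hx => hw x (hright le_rfl hx)) hwq hwq'
      fun s hsr _ hneg => deriv_neg_right_of_sum_deriv_nonneg (hsr.trans hr0)
        (fun x hx => hσ x (hright hsr hx)) (fun x hx => hσ' x (hright hsr hx))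
        (fun x hx => hw x (hright hsr hx)) (fun x hx => hw' x (hright hsr hx)) hwq hwq' hs hneg
    rcases hr with hr | ⟨hr₁, hr₂⟩
    · obtain ⟨m, hqm, hmr⟩ := exists_between hqr
      have hanti : AntitoneOn (fun t => y₁ t - y₂ t) (Ico m r) := by
        have hsub : ∀ {t}, t ∈ Ico m r → t ∈ Ioo q r := fun ht => ⟨hqm.trans_le ht.1, ht.2⟩
        apply antitoneOn_of_hasDerivWithinAt_nonpos (convex_Ico _ _)
          (fun t ht => (hw t (hright le_rfl
            (Ioo_subset_Ico_self (hsub ht)))).continuousAt.continuousWithinAt)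
          (fun t ht => (hw t (hright le_rfl (Ioo_subset_Ico_self
            (hsub (interior_subset ht))))).hasDerivWithinAt)
        exact fun t ht => (key t (hsub (interior_subset ht))).2.le
      refine absurd (le_of_tendsto hr ?_) (not_le.2 (key m ⟨hqm, hmr⟩).1)
      filter_upwards [Ioo_mem_nhdsLT hmr] with t ht
      exact hanti ⟨le_rfl, hmr⟩ ⟨ht.1.le, ht.2⟩ ht.1.le
    · have hsub : ∀ {t}, t ∈ Ioo q r → t ∈ Ioo p r := fun ht => ⟨hpq.trans ht.1, ht.2⟩
      exact no_common_pole_right (κ := 1) hqr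
        (fun x hx => by simpa using h₁ x (hsub hx)) (fun x hx => by simpa using h₂ x (hsub hx))
        hr₁ hr₂ fun x hx => ⟨sub_neg.1 (key x hx).1, sub_neg.1 (key x hx).2⟩

/-- A function which blows up at `c` does not agree near `c` with one continuous at `c`. -/
lemma not_eventuallyEq_of_tendsto_atTop {l : Filter ℝ} [l.NeBot] {c : ℝ} (hl : l ≤ 𝓝 c)
    {u v : ℝ → ℝ} (hu : Tendsto u l atTop) (hv : ContinuousAt v c) : ¬ u =ᶠ[l] v := fun h =>
  not_tendsto_nhds_of_tendsto_atTop (hu.congr' h) _ (hv.tendsto.mono_left hl)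

/-- A set of reals without three increasing elements has at most two elements. -/
lemma encard_le_two_of_no_increasing_triple {S : Set ℝ}
    (h : ∀ p ∈ S, ∀ q ∈ S, ∀ r ∈ S, p < q → q < r → False) : S.encard ≤ 2 := by
  by_contra! hcon
  obtain ⟨T, hTS, hT⟩ := Set.exists_subset_encard_eq (Order.add_one_le_of_lt hcon)
  obtain ⟨x, y, z, hxy, hxz, hyz, rfl⟩ := Set.encard_eq_three.1 (hT.trans (by norm_num))
  have hx : x ∈ S := hTS (by simp)
  have hy : y ∈ S := hTS (by simp)
  have hz : z ∈ S := hTS (by simp)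
  grind

/-- Any two distinct real solutions of `y'' = 6y² - x` (on their maximal
intervals of existence `(a₁,b₁)`, `(a₂,b₂)`, blowing up at the finite
endpoints) have at most two points of intersection with non-positive
abscissas, where a common pole (a common endpoint of the intervals of
existence) counts as an intersection point at infinity. -/
theorem painleveI_at_most_two_intersections
    (a₁ b₁ a₂ b₂ : ℝ) (h₁ab : a₁ < b₁) (h₂ab : a₂ < b₂)
    (y₁ y₁' y₂ y₂' : ℝ → ℝ)
    (h₁ : ∀ x ∈ Set.Ioo a₁ b₁,
      HasDerivAt y₁ (y₁' x) x ∧ HasDerivAt y₁' (6 * (y₁ x) ^ 2 - x) x)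
    (h₂ : ∀ x ∈ Set.Ioo a₂ b₂,
      HasDerivAt y₂ (y₂' x) x ∧ HasDerivAt y₂' (6 * (y₂ x) ^ 2 - x) x)
    (hbl₁ : Tendsto y₁ (𝓝[>] a₁) atTop) (hbr₁ : Tendsto y₁ (𝓝[<] b₁) atTop)
    (hbl₂ : Tendsto y₂ (𝓝[>] a₂) atTop) (hbr₂ : Tendsto y₂ (𝓝[<] b₂) atTop)
    (hdistinct : ¬ (a₁ = a₂ ∧ b₁ = b₂ ∧ ∀ x ∈ Set.Ioo a₁ b₁, y₁ x = y₂ x)) :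
    Set.encard {x : ℝ | x ≤ 0 ∧
      ((x ∈ Set.Ioo a₁ b₁ ∧ x ∈ Set.Ioo a₂ b₂ ∧ y₁ x = y₂ x) ∨
       ((x = a₁ ∨ x = b₁) ∧ (x = a₂ ∨ x = b₂)))} ≤ 2 := by
  -- at equal data the solutions coincide, with the same interval of existence
  have hne : ∀ q, q ∈ Ioo a₁ b₁ → q ∈ Ioo a₂ b₂ → y₁ q = y₂ q → y₁' q ≠ y₂' q := by
    intro q hq₁ hq₂ h0 h0'
    have heq := painleveI_eqOn_of_initial_data
      (a := max a₁ a₂) (b := min b₁ b₂)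
      (fun x hx => h₁ x ⟨(le_max_left _ _).trans_lt hx.1, hx.2.trans_le (min_le_left _ _)⟩)
      (fun x hx => h₂ x ⟨(le_max_right _ _).trans_lt hx.1, hx.2.trans_le (min_le_right _ _)⟩)
      ⟨max_lt hq₁.1 hq₂.1, lt_min hq₁.2 hq₂.2⟩ h0 h0'
    have ha : a₁ = a₂ := by
      rcases lt_trichotomy a₁ a₂ with h | h | h
      · refine absurd ?_ (not_eventuallyEq_of_tendsto_atTop nhdsWithin_le_nhds hbl₂
          (h₁ a₂ ⟨h, hq₂.1.trans hq₁.2⟩).1.continuousAt)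
        filter_upwards [Ioo_mem_nhdsGT hq₂.1] with x hx
        exact (heq x ⟨max_lt (h.trans hx.1) hx.1,
          lt_min (hx.2.trans hq₁.2) (hx.2.trans hq₂.2)⟩).symm
      · exact h
      · refine absurd ?_ (not_eventuallyEq_of_tendsto_atTop nhdsWithin_le_nhds hbl₁
          (h₂ a₁ ⟨h, hq₁.1.trans hq₂.2⟩).1.continuousAt)
        filter_upwards [Ioo_mem_nhdsGT hq₁.1] with x hx
        exact heq x ⟨max_lt hx.1 (h.trans hx.1), lt_min (hx.2.trans hq₁.2) (hx.2.trans hq₂.2)⟩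
    have hb : b₁ = b₂ := by
      rcases lt_trichotomy b₁ b₂ with h | h | h
      · refine absurd ?_ (not_eventuallyEq_of_tendsto_atTop nhdsWithin_le_nhds hbr₁
          (h₂ b₁ ⟨hq₂.1.trans hq₁.2, h⟩).1.continuousAt)
        filter_upwards [Ioo_mem_nhdsLT hq₁.2] with x hx
        exact heq x ⟨max_lt (hq₁.1.trans hx.1) (hq₂.1.trans hx.1), lt_min hx.2 (hx.2.trans h)⟩
      · exact h
      · refine absurd ?_ (not_eventuallyEq_of_tendsto_atTop nhdsWithin_le_nhds hbr₂
          (h₁ b₂ ⟨hq₁.1.trans hq₂.2, h⟩).1.continuousAt)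
        filter_upwards [Ioo_mem_nhdsLT hq₂.2] with x hx
        exact (heq x ⟨max_lt (hq₁.1.trans hx.1) (hq₂.1.trans hx.1),
          lt_min (hx.2.trans h) hx.2⟩).symm
    subst ha hb
    exact hdistinct ⟨rfl, rfl, fun x hx => heq x (by simpa using hx)⟩
  apply encard_le_two_of_no_increasing_triple
  rintro p ⟨_, hp⟩ q ⟨_, hq⟩ r ⟨hr0, hr⟩ hpq hqr
  have hpa₁ : a₁ ≤ p := by grind
  have hpa₂ : a₂ ≤ p := by grind
  have hrb₁ : r ≤ b₁ := by grind
  have hrb₂ : r ≤ b₂ := by grind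
  have hq₁ : q ∈ Ioo a₁ b₁ := ⟨by linarith, by linarith⟩
  have hq₂ : q ∈ Ioo a₂ b₂ := ⟨by linarith, by linarith⟩
  have hq0 : y₁ q = y₂ q := by
    rcases hq with ⟨_, _, h⟩ | ⟨h, _⟩
    · exact h
    · rcases h with h | h
      · exact absurd h hq₁.1.ne'
      · exact absurd h hq₁.2.ne
  have hsub : ∀ x, x ∈ Ioo a₁ b₁ → x ∈ Ioo a₂ b₂ → y₁ x = y₂ x →
      Tendsto (fun x => y₁ x - y₂ x) (𝓝 x) (𝓝 0) := by
    intro x hx₁ hx₂ h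
    have := (h₁ x hx₁).1.continuousAt.tendsto.sub (h₂ x hx₂).1.continuousAt.tendsto
    rwa [h, sub_self] at this
  have hleft : Tendsto (fun x => y₁ x - y₂ x) (𝓝[>] p) (𝓝 0) ∨
      Tendsto y₁ (𝓝[>] p) atTop ∧ Tendsto y₂ (𝓝[>] p) atTop := by
    rcases hp with ⟨hp₁, hp₂, h⟩ | ⟨hp₁, hp₂⟩
    · exact Or.inl ((hsub p hp₁ hp₂ h).mono_left nhdsWithin_le_nhds)
    · have e₁ : p = a₁ := hp₁.resolve_right (hpq.trans hq₁.2).ne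
      have e₂ : p = a₂ := hp₂.resolve_right (hpq.trans hq₂.2).ne
      exact Or.inr ⟨e₁ ▸ hbl₁, e₂ ▸ hbl₂⟩
  have hright : Tendsto (fun x => y₁ x - y₂ x) (𝓝[<] r) (𝓝 0) ∨
      Tendsto y₁ (𝓝[<] r) atTop ∧ Tendsto y₂ (𝓝[<] r) atTop := by
    rcases hr with ⟨hr₁, hr₂, h⟩ | ⟨hr₁, hr₂⟩
    · exact Or.inl ((hsub r hr₁ hr₂ h).mono_left nhdsWithin_le_nhds)
    · have e₁ : r = b₁ := hr₁.resolve_left (hq₁.1.trans hqr).ne'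
      have e₂ : r = b₂ := hr₂.resolve_left (hq₂.1.trans hqr).ne'
      exact Or.inr ⟨e₁ ▸ hbr₁, e₂ ▸ hbr₂⟩
  have hd₁ : ∀ x ∈ Ioo p r, HasDerivAt y₁ (y₁' x) x ∧ HasDerivAt y₁' (6 * (y₁ x) ^ 2 - x) x :=
    fun x hx => h₁ x ⟨hpa₁.trans_lt hx.1, hx.2.trans_le hrb₁⟩
  have hd₂ : ∀ x ∈ Ioo p r, HasDerivAt y₂ (y₂' x) x ∧ HasDerivAt y₂' (6 * (y₂ x) ^ 2 - x) x :=
    fun x hx => h₂ x ⟨hpa₂.trans_lt hx.1, hx.2.trans_le hrb₂⟩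
  have hswap : ∀ {l : Filter ℝ}, (Tendsto (fun x => y₁ x - y₂ x) l (𝓝 0) ∨
      Tendsto y₁ l atTop ∧ Tendsto y₂ l atTop) → (Tendsto (fun x => y₂ x - y₁ x) l (𝓝 0) ∨
      Tendsto y₂ l atTop ∧ Tendsto y₁ l atTop) := by
    rintro l (h | h)
    · exact Or.inl (by simpa using h.neg)
    · exact Or.inr h.symm
  rcases lt_or_gt_of_ne (hne q hq₁ hq₂ hq0) with h | h
  · exact painleveI_no_three_intersections hpq hqr hr0 hd₁ hd₂ hleft hright hq0 h
  · exact painleveI_no_three_intersections hpq hqr hr0 hd₂ hd₁ (hswap hleft) (hswap hright)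
      hq0.symm h
end
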